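/- arXiv:1107.6004 — 9 statements merged into one kernel-verified Lean document; each statement's English description precedes it below -/
import Mathlib

section
/- Let φ* ∈ ℝ^m be a probability vector with μ* nonzero entries and let n ≥ m be an integer. Then there exists ν* ∈ ℕ^m with ν*₁+⋯+ν*_m = n and ν*ᵢ = 0 whenever φ*ᵢ = 0, such that the frequency vector f* = ν*/n satisfies ‖f* − φ*‖∞ ≤ 1/n and ‖f* − φ*‖₁ ≤ 3μ*/(4n). Consequently, for any γ > 0: if n ≥ 1/γ then ‖f* − φ*‖∞ ≤ γ, and if n ≥ 3μ*/(4γ) then ‖f* − φ*‖₁ ≤ γ. -/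
open BigOperators Finset

theorem exists_heavy {ι : Type*} [DecidableEq ι] (S : Finset ι) (r : ι → ℝ) (j : ℕ) :
    ∀ k : ℕ, k + j = S.card → ∃ A ⊆ S, A.card = k ∧
      (k : ℝ) * ∑ i ∈ S, r i ≤ S.card * ∑ i ∈ A, r i := by
  induction j with
  | zero =>
    intro k hk
    refine ⟨S, Finset.Subset.refl _, by omega, ?_⟩
    have : k = S.card := by omega
    rw [this]
  | succ j ih =>
    intro k hk
    obtain ⟨A, hAS, hAc, hA⟩ := ih (k + 1) (by omega)
    have hne : A.Nonempty := Finset.card_pos.mp (by omega)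
    obtain ⟨a, ha, hmin⟩ := Finset.exists_min_image A r hne
    refine ⟨A.erase a, (Finset.erase_subset _ _).trans hAS, ?_, ?_⟩
    · rw [Finset.card_erase_of_mem ha]; omega
    · have h1 : ∑ i ∈ A.erase a, r i + r a = ∑ i ∈ A, r i := Finset.sum_erase_add _ _ ha
      have h2 : (A.card : ℝ) * r a ≤ ∑ i ∈ A, r i := by
        have := Finset.card_nsmul_le_sum A r (r a) hmin
        simpa using this
      rw [hAc] at h2
      push_cast at h2 hA
      set T := ∑ i ∈ S, r i
      set U := ∑ i ∈ A, r i
      have h3 : ∑ i ∈ A.erase a, r i = U - r a := by linarith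
      rw [h3]
      have hk0 : (0 : ℝ) ≤ k := by positivity
      have hk1 : (0 : ℝ) < (k : ℝ) + 1 := by positivity
      have hc : (0 : ℝ) ≤ S.card := by positivity
      refine le_of_mul_le_mul_left ?_ hk1
      have e1 := mul_le_mul_of_nonneg_left hA hk0
      have e2 := mul_le_mul_of_nonneg_left h2 hc
      nlinarith

theorem exists_round (m : ℕ) (φ : Fin m → ℝ)
    (hφ0 : ∀ i, 0 ≤ φ i) (hφ1 : ∑ i, φ i = 1)
    (n : ℕ) :
    ∃ ν : Fin m → ℕ, ∑ i, ν i = n ∧ (∀ i, φ i = 0 → ν i = 0) ∧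
      (∀ i, |(ν i : ℝ) - n * φ i| ≤ 1) ∧
      (∑ i, |(ν i : ℝ) - n * φ i|) ≤ 3 * ((Finset.univ.filter fun i => φ i ≠ 0).card : ℝ) / 4 := by
  set S := Finset.univ.filter fun i => φ i ≠ 0 with hS
  set r : Fin m → ℝ := fun i => n * φ i - ⌊n * φ i⌋₊ with hr
  have hx : ∀ i, 0 ≤ n * φ i := fun i => mul_nonneg (by positivity) (hφ0 i)
  have hr0 : ∀ i, 0 ≤ r i := fun i => sub_nonneg.2 (Nat.floor_le (hx i))
  have hr1 : ∀ i, r i ≤ 1 := fun i => by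
    have := (Nat.lt_floor_add_one (n * φ i)).le
    simp only [hr]; linarith
  have hrS : ∀ i, i ∉ S → r i = 0 := by
    intro i hi
    have : φ i = 0 := by simpa [hS] using hi
    simp [hr, this]
  have hsum : ∑ i, r i = (n : ℝ) - ((∑ i, ⌊n * φ i⌋₊ : ℕ) : ℝ) := by
    simp only [hr, Finset.sum_sub_distrib, ← Finset.mul_sum, hφ1]
    push_cast; ring
  have hle : (∑ i, ⌊n * φ i⌋₊) ≤ n := by
    have : (0 : ℝ) ≤ ∑ i, r i := Finset.sum_nonneg fun i _ => hr0 i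
    rw [hsum] at this
    exact_mod_cast sub_nonneg.1 this
  obtain ⟨k, hk⟩ := Nat.exists_eq_add_of_le hle
  have hsk : ∑ i, r i = k := by
    rw [hsum]
    have : (n : ℝ) = ((∑ i, ⌊n * φ i⌋₊ : ℕ) : ℝ) + k := by exact_mod_cast hk
    linarith
  have hsS : ∑ i ∈ S, r i = k := by
    rw [← hsk]
    exact Finset.sum_subset (Finset.subset_univ _) fun i _ h => hrS i h
  have hkS : k ≤ S.card := by
    have : ∑ i ∈ S, r i ≤ S.card • (1 : ℝ) := Finset.sum_le_card_nsmul _ _ _ fun i _ => hr1 i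
    rw [hsS] at this
    simp only [nsmul_eq_mul, mul_one] at this
    exact_mod_cast this
  obtain ⟨A, hAS, hAc, hA⟩ := exists_heavy S r (S.card - k) k (by omega)
  rw [hsS] at hA
  have habs : ∀ i, |((⌊n * φ i⌋₊ + if i ∈ A then 1 else 0 : ℕ) : ℝ) - n * φ i|
      = r i + if i ∈ A then 1 - 2 * r i else 0 := by
    intro i
    have h0 := hr0 i
    have h1 := hr1 i
    by_cases h : i ∈ A
    · simp only [h, if_true]
      rw [abs_of_nonneg] <;> push_cast <;> simp only [hr] at * <;> linarith
    · simp only [h, if_false]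
      rw [abs_of_nonpos] <;> push_cast <;> simp only [hr] at * <;> linarith
  refine ⟨fun i => ⌊n * φ i⌋₊ + if i ∈ A then 1 else 0, ?_, ?_, ?_, ?_⟩
  · rw [Finset.sum_add_distrib]
    simp only [Finset.sum_ite_mem, Finset.univ_inter, Finset.sum_const, hAc, smul_eq_mul, mul_one]
    exact hk.symm
  · intro i hi
    have : i ∉ A := fun h => by
      have := hAS h
      simp [hS, hi] at this
    simp [hi, this]
  · intro i
    rw [habs]
    have h0 := hr0 i
    have h1 := hr1 i
    split_ifs <;> linarith
  · simp only [habs]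
    rw [Finset.sum_add_distrib, hsk]
    simp only [Finset.sum_ite_mem, Finset.univ_inter, Finset.sum_sub_distrib, Finset.sum_const,
      hAc, nsmul_eq_mul, mul_one, ← Finset.mul_sum]
    set U := ∑ i ∈ A, r i
    rcases Nat.eq_zero_or_pos S.card with h | h
    · have hk0 : k = 0 := by omega
      have : A = ∅ := Finset.card_eq_zero.1 (by omega)
      simp [U, this, h, hk0]
    · have h' : (0 : ℝ) < S.card := by exact_mod_cast h
      refine le_of_mul_le_mul_left ?_ h'
      nlinarith [sq_nonneg ((S.card : ℝ) - 2 * k)]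

/-- Rounding and adjusting a probability vector `φ*` produces, for any
`n ≥ m`, a count vector `ν*` summing to `n`, vanishing where `φ*` vanishes, whose
frequency vector `f* = ν*/n` is within `1/n` of `φ*` in ℓ∞ norm and within
`3μ*/(4n)` in ℓ1 norm; consequently for any `γ > 0`, `n ≥ 1/γ` gives ℓ∞ distance
`≤ γ` and `n ≥ 3μ*/(4γ)` gives ℓ1 distance `≤ γ`. -/
theorem stmt_0 (m : ℕ) (hm : 2 ≤ m) (φ : Fin m → ℝ)
    (hφ0 : ∀ i, 0 ≤ φ i) (hφ1 : ∑ i, φ i = 1)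
    (μ : ℕ) (hμ : μ = (Finset.univ.filter fun i => φ i ≠ 0).card)
    (n : ℕ) (hn : m ≤ n) :
    ∃ ν : Fin m → ℕ, ∑ i, ν i = n ∧ (∀ i, φ i = 0 → ν i = 0) ∧
      (∀ i, |(ν i : ℝ) / n - φ i| ≤ 1 / n) ∧
      (∑ i, |(ν i : ℝ) / n - φ i|) ≤ 3 * μ / (4 * n) ∧
      ∀ γ : ℝ, 0 < γ →
        ((1 / γ ≤ (n : ℝ) → ∀ i, |(ν i : ℝ) / n - φ i| ≤ γ) ∧
         (3 * μ / (4 * γ) ≤ (n : ℝ) → ∑ i, |(ν i : ℝ) / n - φ i| ≤ γ)) := by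
  obtain ⟨ν, h1, h2, h3, h4⟩ := exists_round m φ hφ0 hφ1 n
  rw [← hμ] at h4
  have hn0 : (0 : ℝ) < n := by
    have : 0 < n := by omega
    exact_mod_cast this
  have key : ∀ i, |(ν i : ℝ) / n - φ i| = |(ν i : ℝ) - n * φ i| / n := by
    intro i
    rw [← abs_of_pos hn0, ← abs_div, abs_of_pos hn0]
    congr 1
    field_simp
  have hinf : ∀ i, |(ν i : ℝ) / n - φ i| ≤ 1 / n := by
    intro i
    rw [key]
    exact div_le_div_of_nonneg_right (h3 i) hn0.le
  have hone : (∑ i, |(ν i : ℝ) / n - φ i|) ≤ 3 * μ / (4 * n) := by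
    simp only [key]
    rw [← Finset.sum_div, ← div_div]
    exact div_le_div_of_nonneg_right h4 hn0.le
  refine ⟨ν, h1, h2, hinf, hone, fun γ hγ => ⟨fun h i => (hinf i).trans ?_, fun h => hone.trans ?_⟩⟩
  · rw [div_le_iff₀ hγ] at h
    rw [div_le_iff₀ hn0]; linarith
  · rw [div_le_iff₀ (by positivity)] at h ⊢
    linarith
end

section
/- Let f and φ be probability vectors in ℝ^m and let 0 < γ ≤ 1/e. If ‖f − φ‖∞ ≤ γ, then |H(φ) − H(f)| ≤ m·γ·ln(1/γ). -/
open BigOperators Finset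

lemma aux_tangent (a b : ℝ) (ha : 0 ≤ a) (hab : a ≤ b) :
    b * Real.log b - a * Real.log a ≤ (b - a) * Real.log b + (b - a) := by
  rcases ha.eq_or_lt with h | h
  · subst h; simp; linarith
  · have hb : 0 < b := by linarith
    have h1 := Real.log_le_sub_one_of_pos (div_pos hb h)
    rw [Real.log_div hb.ne' h.ne'] at h1
    have h2 := mul_le_mul_of_nonneg_left h1 h.le
    have h3 : a * (b / a - 1) = b - a := by field_simp
    nlinarith

lemma aux_mul_log (a b : ℝ) (ha : 0 ≤ a) (hab : a ≤ b) :
    a * Real.log a ≤ a * Real.log b := by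
  rcases ha.eq_or_lt with h | h
  · subst h; simp
  · exact mul_le_mul_of_nonneg_left (Real.log_le_log h hab) h.le

lemma aux_pt (a b γ : ℝ) (ha : 0 ≤ a) (hab : a ≤ b) (hb : b ≤ 1)
    (hl : Real.log γ ≤ -1) (hγ0 : 0 < γ) (hd : b - a ≤ γ) :
    |b * Real.log b - a * Real.log a| ≤ γ * (-Real.log γ) := by
  rw [abs_le]
  have hd0 : 0 ≤ b - a := by linarith
  constructor
  · have h1 := aux_mul_log a b ha hab
    have h2 := aux_mul_log (b - a) b hd0 (by linarith)
    have h3 := aux_tangent (b - a) γ hd0 hd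
    nlinarith
  · have h1 := aux_tangent a b ha hab
    have h2 : Real.log b ≤ 0 := Real.log_nonpos (by linarith) hb
    nlinarith

/-- If two probability vectors `f, φ` in `ℝ^m` satisfy
`‖f − φ‖∞ ≤ γ` with `0 < γ ≤ 1/e`, then `|H(φ) − H(f)| ≤ m·γ·ln(1/γ)`. -/
theorem stmt_2 (m : ℕ) (hm : 2 ≤ m) (f φ : Fin m → ℝ)
    (hf0 : ∀ i, 0 ≤ f i) (hf1 : ∑ i, f i = 1)
    (hφ0 : ∀ i, 0 ≤ φ i) (hφ1 : ∑ i, φ i = 1)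
    (γ : ℝ) (hγ0 : 0 < γ) (hγe : γ ≤ 1 / Real.exp 1)
    (hclose : ∀ i, |f i - φ i| ≤ γ) :
    |(-∑ i, φ i * Real.log (φ i)) - (-∑ i, f i * Real.log (f i))| ≤
      m * γ * Real.log (1 / γ) := by
  have hl : Real.log γ ≤ -1 := by
    have := Real.log_le_log hγ0 hγe
    simpa using this
  have hle : ∀ g : Fin m → ℝ, (∀ i, 0 ≤ g i) → ∑ i, g i = 1 → ∀ i, g i ≤ 1 := by
    intro g h0 h1 i
    rw [← h1]
    exact Finset.single_le_sum (fun j _ => h0 j) (Finset.mem_univ i)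
  have hpt : ∀ i, |f i * Real.log (f i) - φ i * Real.log (φ i)| ≤ γ * (-Real.log γ) := by
    intro i
    have hc := abs_le.mp (hclose i)
    rcases le_total (φ i) (f i) with h | h
    · exact aux_pt _ _ _ (hφ0 i) h (hle f hf0 hf1 i) hl hγ0 hc.2
    · rw [abs_sub_comm]
      exact aux_pt _ _ _ (hf0 i) h (hle φ hφ0 hφ1 i) hl hγ0 (by linarith [hc.1])
  have e : (-∑ i, φ i * Real.log (φ i)) - (-∑ i, f i * Real.log (f i)) =
      ∑ i, (f i * Real.log (f i) - φ i * Real.log (φ i)) := by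
    rw [Finset.sum_sub_distrib]; ring
  rw [e]
  refine (Finset.abs_sum_le_sum_abs _ _).trans ((Finset.sum_le_sum fun i _ => hpt i).trans ?_)
  simp [mul_assoc]
end

section
/- Let ν ∈ ℕ^m with ν₁+⋯+ν_m = n ≥ 1, set f = ν/n, let μ ≥ 1 be the number of nonzero entries of ν, and define S(f,n) = (2πn)^{−(μ−1)/2} · ∏_{i : νᵢ>0} fᵢ^{−1/2}. Then the multinomial coefficient #f = n!/(ν₁!⋯ν_m!) satisfies exp(−(1/(12n))·Σ_{i : νᵢ>0} 1/fᵢ)·e^{n·H(f)} ≤ #f / S(f,n) ≤ e^{1/(12n)}·e^{n·H(f)}. -/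
open BigOperators Finset

lemma log_stirlingSeq_sub_mono :
    Monotone (fun n : ℕ => Real.log (Stirling.stirlingSeq (n + 1)) - 1 / (12 * ((n : ℝ) + 1))) := by
  refine monotone_nat_of_le_succ fun n => ?_
  have h := Stirling.log_stirlingSeq_sdiff_le (n + 1)
  have e : (1 : ℝ) / (12 * ((n + 1 : ℕ) : ℝ) * (((n + 1 : ℕ) : ℝ) + 1))
      = 1 / (12 * ((n : ℝ) + 1)) - 1 / (12 * (((n + 1 : ℕ) : ℝ) + 1)) := by
    push_cast
    field_simp
    ring
  rw [e] at h
  linarith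

lemma log_stirlingSeq_le (n : ℕ) :
    Real.log (Stirling.stirlingSeq (n + 1)) ≤ Real.log (√Real.pi) + 1 / (12 * ((n : ℝ) + 1)) := by
  have hpi : √Real.pi ≠ 0 := by positivity
  have h1 : Filter.Tendsto (fun n : ℕ => Real.log (Stirling.stirlingSeq (n + 1)))
      Filter.atTop (nhds (Real.log (√Real.pi))) :=
    (Stirling.tendsto_stirlingSeq_sqrt_pi.comp (Filter.tendsto_add_atTop_nat 1)).log hpi
  have h2 : Filter.Tendsto (fun n : ℕ => 1 / (12 * ((n : ℝ) + 1))) Filter.atTop (nhds 0) := by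
    have := (tendsto_one_div_add_atTop_nhds_zero_nat (𝕜 := ℝ)).const_mul (1 / 12)
    rw [mul_zero] at this
    refine this.congr fun n => ?_
    field_simp
  have h3 := h1.sub h2
  have := log_stirlingSeq_sub_mono.ge_of_tendsto h3 n
  linarith

lemma log_factorial_le {n : ℕ} (hn : n ≠ 0) :
    Real.log (n.factorial : ℝ) ≤ n * Real.log n - n + Real.log n / 2 + Real.log (2 * Real.pi) / 2
      + 1 / (12 * n) := by
  obtain ⟨k, rfl⟩ := Nat.exists_eq_succ_of_ne_zero hn
  have h := log_stirlingSeq_le k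
  rw [Stirling.log_stirlingSeq_formula, Real.log_sqrt Real.pi_pos.le,
    Real.log_mul (by norm_num) (by positivity), Real.log_div (by positivity) (by positivity),
    Real.log_exp] at h
  rw [Real.log_mul (by norm_num) (by positivity)]
  simp only [Nat.succ_eq_add_one]
  push_cast at h ⊢
  linarith

/-- Sharp Stirling-type bounds on the multinomial coefficient
`#f = n!/(ν₁!⋯ν_m!)` in terms of `S(f,n) = (2πn)^{−(μ−1)/2}·∏_{νᵢ>0} fᵢ^{−1/2}`
and the entropy `H(f)` of `f = ν/n`. -/
theorem stmt_4 (m n : ℕ) (hm : 1 ≤ m) (hn : 1 ≤ n)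
    (ν : Fin m → ℕ) (hν : ∑ i, ν i = n)
    (f : Fin m → ℝ) (hf : f = fun i => (ν i : ℝ) / n)
    (μ : ℕ) (hμ : μ = (Finset.univ.filter fun i => ν i ≠ 0).card)
    (S : ℝ) (hS : S = (2 * Real.pi * n) ^ (-(((μ : ℝ) - 1) / 2)) *
      ∏ i ∈ Finset.univ.filter (fun i => ν i ≠ 0), (f i) ^ (-(1 / 2 : ℝ)))
    (Hf : ℝ) (hHf : Hf = -∑ i, f i * Real.log (f i)) :
    Real.exp (-(1 / (12 * n)) * ∑ i ∈ Finset.univ.filter (fun i => ν i ≠ 0), 1 / f i) *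
        Real.exp (n * Hf) ≤ (Nat.multinomial Finset.univ ν : ℝ) / S ∧
    (Nat.multinomial Finset.univ ν : ℝ) / S ≤ Real.exp (1 / (12 * n)) * Real.exp (n * Hf) := by
  have hn0 : n ≠ 0 := by omega
  have hnR : (0 : ℝ) < n := by positivity
  have hpi : (0 : ℝ) < 2 * Real.pi := by positivity
  set A := Finset.univ.filter (fun i => ν i ≠ 0) with hA
  have hApos : ∀ i ∈ A, (0 : ℝ) < ν i := fun i hi => by
    have : ν i ≠ 0 := (Finset.mem_filter.mp hi).2
    positivity
  have hAne : ∀ i ∈ A, ν i ≠ 0 := fun i hi => (Finset.mem_filter.mp hi).2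
  have hfpos : ∀ i ∈ A, (0 : ℝ) < f i := fun i hi => by
    rw [hf]; exact div_pos (hApos i hi) hnR
  have hPpos : 0 < ∏ i ∈ A, (f i) ^ (-(1 / 2 : ℝ)) :=
    Finset.prod_pos fun i hi => Real.rpow_pos_of_pos (hfpos i hi) _
  have hSpos : 0 < S := by
    rw [hS]; exact mul_pos (Real.rpow_pos_of_pos (by positivity) _) hPpos
  have hMpos : (0 : ℝ) < (Nat.multinomial Finset.univ ν : ℝ) := by
    exact_mod_cast Nat.multinomial_pos _ _
  have hlogf : ∀ i ∈ A, Real.log (f i) = Real.log (ν i) - Real.log n := fun i hi => by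
    rw [hf]; exact Real.log_div (hApos i hi).ne' hnR.ne'
  have hsumν : ∑ i ∈ A, (ν i : ℝ) = n := by
    rw [← hν, hA, Finset.sum_filter_of_ne]
    · push_cast; rfl
    · intro i _ h h0
      exact h (by simp [h0])
  have hlogS : Real.log S = -(((μ : ℝ) - 1) / 2) * (Real.log (2 * Real.pi) + Real.log n)
      - 1 / 2 * (∑ i ∈ A, Real.log (ν i) - μ * Real.log n) := by
    rw [hS, Real.log_mul (by positivity) hPpos.ne', Real.log_rpow (by positivity),
      Real.log_mul hpi.ne' hnR.ne',
      Real.log_prod (fun i hi => (Real.rpow_pos_of_pos (hfpos i hi) _).ne')]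
    have : ∑ i ∈ A, Real.log (f i ^ (-(1 / 2 : ℝ)))
        = ∑ i ∈ A, (-(1 / 2 : ℝ)) * (Real.log (ν i) - Real.log n) :=
      Finset.sum_congr rfl fun i hi => by rw [Real.log_rpow (hfpos i hi), hlogf i hi]
    rw [this, ← Finset.mul_sum, Finset.sum_sub_distrib, Finset.sum_const, ← hμ, nsmul_eq_mul]
    ring
  have hH : n * Hf = n * Real.log n - ∑ i ∈ A, ν i * Real.log (ν i) := by
    have h1 : ∑ i, f i * Real.log (f i) = ∑ i ∈ A, f i * Real.log (f i) := by
      rw [hA, Finset.sum_filter_of_ne]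
      intro i _ h h0
      exact h (by simp [hf, h0])
    have h2 : (n : ℝ) * ∑ i ∈ A, f i * Real.log (f i)
        = ∑ i ∈ A, (ν i * Real.log (ν i) - ν i * Real.log n) := by
      rw [Finset.mul_sum]
      refine Finset.sum_congr rfl fun i hi => ?_
      rw [hlogf i hi, hf]
      field_simp
    rw [Finset.sum_sub_distrib, ← Finset.sum_mul, hsumν] at h2
    rw [hHf, h1]
    linarith
  have hlogM : Real.log (Nat.multinomial Finset.univ ν : ℝ)
      = Real.log (n.factorial : ℝ) - ∑ i ∈ A, Real.log ((ν i).factorial : ℝ) := by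
    have h := Nat.multinomial_spec Finset.univ ν
    rw [hν] at h
    have h' : (∏ i, ((ν i).factorial : ℝ)) * (Nat.multinomial Finset.univ ν : ℝ)
        = (n.factorial : ℝ) := by exact_mod_cast h
    rw [← h', Real.log_mul (Finset.prod_ne_zero_iff.mpr fun i _ => by positivity) hMpos.ne',
      Real.log_prod (fun i _ => by positivity), hA, Finset.sum_filter_of_ne]
    · ring
    · intro i _ h h0
      exact h (by simp [h0])
  have hsumf : -(1 / (12 * (n : ℝ))) * ∑ i ∈ A, 1 / f i = - ∑ i ∈ A, 1 / (12 * (ν i : ℝ)) := by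
    rw [neg_mul, Finset.mul_sum]
    congr 1
    refine Finset.sum_congr rfl fun i hi => ?_
    have := (hApos i hi).ne'
    rw [hf]
    field_simp
  have hlo : ∑ i ∈ A, (ν i * Real.log (ν i) - ν i + Real.log (ν i) / 2
      + Real.log (2 * Real.pi) / 2) ≤ ∑ i ∈ A, Real.log ((ν i).factorial : ℝ) :=
    Finset.sum_le_sum fun i hi => Stirling.le_log_factorial_stirling (hAne i hi)
  have hup : ∑ i ∈ A, Real.log ((ν i).factorial : ℝ) ≤ ∑ i ∈ A, (ν i * Real.log (ν i) - ν i
      + Real.log (ν i) / 2 + Real.log (2 * Real.pi) / 2 + 1 / (12 * (ν i : ℝ))) :=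
    Finset.sum_le_sum fun i hi => log_factorial_le (hAne i hi)
  simp only [Finset.sum_add_distrib, Finset.sum_sub_distrib, Finset.sum_const, ← hμ,
    nsmul_eq_mul, hsumν, ← Finset.sum_div] at hlo
  rw [Finset.sum_add_distrib] at hup
  simp only [Finset.sum_add_distrib (f := fun i => (ν i : ℝ) * Real.log (ν i) - ν i
      + Real.log (ν i) / 2), Finset.sum_add_distrib (f := fun i => (ν i : ℝ) * Real.log (ν i) - ν i),
    Finset.sum_sub_distrib, Finset.sum_const, ← hμ,
    nsmul_eq_mul, hsumν, ← Finset.sum_div] at hup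
  have hnlo := Stirling.le_log_factorial_stirling hn0
  have hnup := log_factorial_le hn0
  have hMS : (Nat.multinomial Finset.univ ν : ℝ) / S
      = Real.exp (Real.log (Nat.multinomial Finset.univ ν : ℝ) - Real.log S) := by
    rw [Real.exp_sub, Real.exp_log hMpos, Real.exp_log hSpos]
  rw [hMS, ← Real.exp_add, ← Real.exp_add, Real.exp_le_exp, Real.exp_le_exp, hsumf, hH, hlogM,
    hlogS]
  constructor <;> linarith
end

section
/- For every integer μ ≥ 2 and every integer n ≥ 1, the sum of 1/√(ν₁·ν₂⋯ν_μ) over all ν ∈ ℕ^μ with ν₁+⋯+ν_μ = n and νᵢ ≥ 1 for all i is strictly less than (π^{μ/2}/Γ(μ/2))·n^{μ/2 − 1}, where Γ is the Gamma function. -/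
open BigOperators Finset

lemma aux_beta (s t a : ℝ) (hs : 0 < s) (ht : 0 < t) (ha : 0 < a) :
    ∫ x in (0:ℝ)..a, x ^ (s - 1) * (a - x) ^ (t - 1) =
      a ^ (s + t - 1) * (Real.Gamma s * Real.Gamma t / Real.Gamma (s + t)) := by
  have h := Complex.betaIntegral_scaled (s : ℂ) (t : ℂ) ha
  have hG := Complex.Gamma_mul_Gamma_eq_betaIntegral (s := (s : ℂ)) (t := (t : ℂ))
    (by simpa using hs) (by simpa using ht)
  have hG0 : Real.Gamma (s + t) ≠ 0 := (Real.Gamma_pos_of_pos (by positivity)).ne'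
  have hb : Complex.betaIntegral s t =
      ((Real.Gamma s * Real.Gamma t / Real.Gamma (s + t) : ℝ) : ℂ) := by
    have hG0' : ((Real.Gamma (s + t) : ℝ) : ℂ) ≠ 0 := by exact_mod_cast hG0
    rw [← Complex.ofReal_add, Complex.Gamma_ofReal, Complex.Gamma_ofReal,
      Complex.Gamma_ofReal] at hG
    push_cast
    rw [eq_div_iff hG0', hG, mul_comm]
  rw [hb] at h
  have h2 : ∫ x in (0:ℝ)..a, (x : ℂ) ^ ((s : ℂ) - 1) * ((a : ℂ) - x) ^ ((t : ℂ) - 1) =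
      ∫ x in (0:ℝ)..a, ((x ^ (s - 1) * (a - x) ^ (t - 1) : ℝ) : ℂ) := by
    apply intervalIntegral.integral_congr
    intro x hx
    rw [Set.uIcc_of_le ha.le] at hx
    simp only
    rw [Complex.ofReal_mul, Complex.ofReal_cpow hx.1, Complex.ofReal_cpow (by linarith [hx.2])]
    push_cast
    rfl
  rw [h2, intervalIntegral.integral_ofReal] at h
  have h3 : (a : ℂ) ^ ((s : ℂ) + t - 1) = ((a ^ (s + t - 1) : ℝ) : ℂ) := by
    rw [Complex.ofReal_cpow ha.le]; push_cast; rfl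
  rw [h3] at h
  exact_mod_cast h

lemma aux_int (s t a : ℝ) (hs : 0 < s) (ht : 0 < t) (ha : 0 < a) :
    IntervalIntegrable (fun x : ℝ => x ^ (s - 1) * (a - x) ^ (t - 1)) MeasureTheory.volume 0 a := by
  apply intervalIntegral.intervalIntegrable_of_integral_ne_zero
  rw [aux_beta s t a hs ht ha]
  have := Real.Gamma_pos_of_pos hs
  have := Real.Gamma_pos_of_pos ht
  have := Real.Gamma_pos_of_pos (add_pos hs ht)
  positivity

lemma aux_sub {f : ℝ → ℝ} {a b c : ℝ}
    (hf : IntervalIntegrable f MeasureTheory.volume 0 a) (hb : 0 ≤ b) (hbc : b ≤ c) (hc : c ≤ a) :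
    IntervalIntegrable f MeasureTheory.volume b c := by
  apply hf.mono_set
  rw [Set.uIcc_of_le hbc, Set.uIcc_of_le (by linarith)]
  exact Set.Icc_subset_Icc hb hc

/-- generic comparison of sum and integral -/
lemma aux_cmp (f : ℝ → ℝ) (m : ℕ) (c : ℝ) (hc : 0 ≤ c) (hc1 : c < 1)
    (hf : IntervalIntegrable f MeasureTheory.volume 0 ((m : ℝ) + 1))
    (hpos : ∀ x, 0 < x → x < (m : ℝ) + 1 → 0 < f x)
    (hk : ∀ k : ℕ, k < m → f ((k : ℝ) + 1) ≤ ∫ x in (c + k)..(c + k + 1), f x) :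
    ∑ k ∈ Finset.range m, f ((k : ℝ) + 1) < ∫ x in (0:ℝ)..((m : ℝ) + 1), f x := by
  have hm : (0:ℝ) ≤ m := by positivity
  have e1 := intervalIntegral.integral_add_adjacent_intervals
    (aux_sub hf (b := 0) (c := c) le_rfl hc (by linarith))
    (aux_sub hf (b := c) (c := c + m) hc (by linarith) (by linarith))
  have e2 := intervalIntegral.integral_add_adjacent_intervals
    (aux_sub hf (b := 0) (c := c + m) le_rfl (by linarith) (by linarith))
    (aux_sub hf (b := c + m) (c := m + 1) (by linarith) (by linarith) (by linarith))
  have p1 : 0 ≤ ∫ x in (0:ℝ)..c, f x := by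
    rcases hc.eq_or_lt with h | h
    · simp [← h]
    · exact (intervalIntegral.intervalIntegral_pos_of_pos_on
        (aux_sub hf (b := 0) (c := c) le_rfl hc (by linarith))
        (fun x hx => hpos x hx.1 (by linarith [hx.2])) h).le
  have p2 : 0 < ∫ x in (c + m)..((m : ℝ) + 1), f x :=
    intervalIntegral.intervalIntegral_pos_of_pos_on
      (aux_sub hf (by linarith) (by linarith) (by linarith))
      (fun x hx => hpos x (by linarith [hx.1]) (by linarith [hx.2])) (by linarith)
  have e3 := intervalIntegral.sum_integral_adjacent_intervals (f := f)
    (μ := MeasureTheory.volume) (a := fun k : ℕ => c + (k : ℝ)) (n := m) (by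
      intro k hkm
      have : (k : ℝ) + 1 ≤ m := by exact_mod_cast hkm
      have : (0 : ℝ) ≤ k := by positivity
      apply aux_sub hf <;> push_cast <;> linarith)
  have e4 : ∑ k ∈ Finset.range m, f ((k : ℝ) + 1) ≤
      ∑ k ∈ Finset.range m, ∫ x in (c + (k : ℝ))..(c + ((k + 1 : ℕ) : ℝ)), f x := by
    apply Finset.sum_le_sum
    intro k hkm
    have := hk k (Finset.mem_range.mp hkm)
    push_cast
    rw [← add_assoc]
    exact this
  simp only [Nat.cast_zero, add_zero] at e3
  linarith

lemma aux_sum (m : ℕ) (t : ℝ) (ht : t = 1 / 2 ∨ 1 ≤ t) :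
    ∑ k ∈ Finset.range m, ((k : ℝ) + 1) ^ ((1 / 2 : ℝ) - 1) *
        (((m : ℝ) + 1) - ((k : ℝ) + 1)) ^ (t - 1) <
      ((m : ℝ) + 1) ^ ((1 / 2 : ℝ) + t - 1) *
        (Real.Gamma (1 / 2) * Real.Gamma t / Real.Gamma (1 / 2 + t)) := by
  have ht0 : 0 < t := by rcases ht with h | h <;> linarith
  have hm : (0:ℝ) < (m : ℝ) + 1 := by positivity
  have hint := aux_int (1/2) t _ (by norm_num) ht0 hm
  rw [← aux_beta (1/2) t _ (by norm_num) ht0 hm]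
  have hpos : ∀ x : ℝ, 0 < x → x < (m : ℝ) + 1 →
      0 < x ^ ((1 / 2 : ℝ) - 1) * (((m : ℝ) + 1) - x) ^ (t - 1) := by
    intro x h1 h2
    have : 0 < (m : ℝ) + 1 - x := by linarith
    positivity
  rcases ht with rfl | ht
  · refine aux_cmp (fun x : ℝ => x ^ ((1 / 2 : ℝ) - 1) * (((m : ℝ) + 1) - x) ^ ((1 / 2 : ℝ) - 1))
      m (1/2) (by norm_num) (by norm_num) hint hpos ?_
    intro k hkm
    have hkm' : (k : ℝ) + 1 ≤ m := by exact_mod_cast hkm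
    have hk0 : (0 : ℝ) ≤ k := by positivity
    set f : ℝ → ℝ := fun x : ℝ => x ^ ((1 / 2 : ℝ) - 1) * (((m : ℝ) + 1) - x) ^ ((1 / 2 : ℝ) - 1)
      with hfdef
    have hi : IntervalIntegrable f MeasureTheory.volume (1/2 + (k:ℝ)) (1/2 + k + 1) :=
      aux_sub hint (by linarith) (by linarith) (by linarith)
    have e : ∫ x in (1/2 + (k:ℝ))..(1/2 + k + 1), f (2 * (k + 1) - x) =
        ∫ x in (1/2 + (k:ℝ))..(1/2 + k + 1), f x := by
      rw [intervalIntegral.integral_comp_sub_left]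
      congr 1 <;> ring
    have hi2 : IntervalIntegrable (fun x => f (2 * (k + 1) - x)) MeasureTheory.volume
        (1/2 + (k:ℝ)) (1/2 + k + 1) := by
      have := (hi.comp_sub_left (2 * ((k:ℝ) + 1))).symm
      convert this using 1 <;> ring
    have key : ∫ x in (1/2 + (k:ℝ))..(1/2 + k + 1), (2 * f (k + 1)) ≤
        ∫ x in (1/2 + (k:ℝ))..(1/2 + k + 1), (f x + f (2 * (k + 1) - x)) := by
      apply intervalIntegral.integral_mono_on_of_le_Ioo (by linarith) (by simp) (hi.add hi2)
      intro x hx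
      obtain ⟨hx1, hx2⟩ := hx
      have fe : ∀ y : ℝ, 0 < y → y < (m:ℝ) + 1 → f y = (y * ((m:ℝ) + 1 - y)) ^ ((1 / 2 : ℝ) - 1) := by
        intro y h1 h2
        rw [hfdef, Real.mul_rpow h1.le (by linarith)]
      have a1 : 0 < f x := hpos x (by linarith) (by linarith)
      have a2 : 0 < f (2 * (k + 1) - x) := hpos _ (by linarith) (by linarith)
      have a3 : 0 < f (k + 1) := hpos _ (by linarith) (by linarith)
      have hpq : f (k + 1) * f (k + 1) ≤ f x * f (2 * (k + 1) - x) := by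
        rw [fe x (by linarith) (by linarith), fe (2 * (k + 1) - x) (by linarith) (by linarith),
          fe (k + 1) (by linarith) (by linarith)]
        have b1 : 0 < x * ((m:ℝ) + 1 - x) := mul_pos (by linarith) (by linarith)
        have b2 : 0 < (2 * (k + 1) - x) * ((m:ℝ) + 1 - (2 * (k + 1) - x)) :=
          mul_pos (by linarith) (by linarith)
        have b3 : 0 < ((k:ℝ) + 1) * ((m:ℝ) + 1 - (k + 1)) := mul_pos (by linarith) (by linarith)
        rw [← Real.mul_rpow b3.le b3.le, ← Real.mul_rpow b1.le b2.le]
        apply Real.rpow_le_rpow_of_nonpos (mul_pos b1 b2) _ (by norm_num)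
        have c1 : x * (2 * (k + 1) - x) ≤ ((k:ℝ) + 1) * (k + 1) := by
          nlinarith [sq_nonneg (x - (k + 1))]
        have c2 : ((m:ℝ) + 1 - x) * ((m:ℝ) + 1 - (2 * (k + 1) - x)) ≤
            ((m:ℝ) + 1 - (k + 1)) * ((m:ℝ) + 1 - (k + 1)) := by
          nlinarith [sq_nonneg (x - (k + 1))]
        have c3 := mul_le_mul c1 c2 (mul_nonneg (by linarith) (by linarith)) (by positivity)
        linarith
      nlinarith [sq_nonneg (f x - f (2 * (k + 1) - x))]
    rw [intervalIntegral.integral_add hi hi2, e, intervalIntegral.integral_const] at key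
    have : (1/2 + (k:ℝ) + 1 - (1/2 + k)) = 1 := by ring
    rw [this, one_smul] at key
    change f ((k:ℝ) + 1) ≤ _
    linarith
  · refine aux_cmp (fun x : ℝ => x ^ ((1 / 2 : ℝ) - 1) * (((m : ℝ) + 1) - x) ^ (t - 1))
      m 0 le_rfl (by norm_num) hint hpos ?_
    intro k hkm
    have hkm' : (k : ℝ) + 1 ≤ m := by exact_mod_cast hkm
    have hk0 : (0 : ℝ) ≤ k := by positivity
    set f : ℝ → ℝ := fun x : ℝ => x ^ ((1 / 2 : ℝ) - 1) * (((m : ℝ) + 1) - x) ^ (t - 1)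
      with hfdef
    have hi : IntervalIntegrable f MeasureTheory.volume (0 + (k:ℝ)) (0 + k + 1) :=
      aux_sub hint (by linarith) (by linarith) (by linarith)
    have key : ∫ x in (0 + (k:ℝ))..(0 + k + 1), (f (k + 1)) ≤
        ∫ x in (0 + (k:ℝ))..(0 + k + 1), f x := by
      apply intervalIntegral.integral_mono_on_of_le_Ioo (by linarith) (by simp) hi
      intro x hx
      obtain ⟨hx1, hx2⟩ := hx
      have h1 : ((k:ℝ) + 1) ^ ((1 / 2 : ℝ) - 1) ≤ x ^ ((1 / 2 : ℝ) - 1) :=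
        Real.rpow_le_rpow_of_nonpos (by linarith) (by linarith) (by norm_num)
      have h2 : ((m:ℝ) + 1 - (k + 1)) ^ (t - 1) ≤ ((m:ℝ) + 1 - x) ^ (t - 1) :=
        Real.rpow_le_rpow (by linarith) (by linarith) (by linarith)
      exact mul_le_mul h1 h2 (Real.rpow_nonneg (by linarith) _) (Real.rpow_nonneg (by linarith) _)
    rw [intervalIntegral.integral_const] at key
    have : (0 + (k:ℝ) + 1 - (0 + k)) = 1 := by ring
    rw [this, one_smul] at key
    exact key

noncomputable def auxS (μ n : ℕ) : ℝ :=
  ∑ ν ∈ Finset.Nat.antidiagonalTuple μ n, ∏ i, (1 / Real.sqrt (ν i : ℝ))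

lemma auxS_succ (μ n : ℕ) :
    auxS (μ + 1) n = ∑ p ∈ Finset.HasAntidiagonal.antidiagonal n, 1 / Real.sqrt (p.1 : ℝ) * auxS μ p.2 := by
  unfold auxS
  simp_rw [Finset.mul_sum]
  rw [Finset.sum_sigma']
  symm
  refine Finset.sum_bij (fun q _ => Fin.cons q.1.1 q.2) ?_ ?_ ?_ ?_
  · rintro ⟨⟨a, b⟩, ν⟩ h
    simp [Finset.Nat.mem_antidiagonalTuple, Fin.sum_univ_succ] at h ⊢
    omega
  · rintro ⟨⟨a, b⟩, ν⟩ h ⟨⟨a', b'⟩, ν'⟩ h' heq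
    simp only [Finset.mem_sigma, Finset.HasAntidiagonal.mem_antidiagonal,
      Finset.Nat.mem_antidiagonalTuple] at h h'
    obtain ⟨h1, h2⟩ : a = a' ∧ ν = ν' := Fin.cons_injective2 heq
    subst h1 h2
    obtain rfl : b = b' := by omega
    rfl
  · intro ν h
    rw [Finset.Nat.mem_antidiagonalTuple, Fin.sum_univ_succ] at h
    refine ⟨⟨⟨ν 0, ∑ i : Fin μ, ν i.succ⟩, Fin.tail ν⟩, ?_, ?_⟩
    · simp [Finset.Nat.mem_antidiagonalTuple, Fin.tail, h]
    · simp
  · rintro ⟨⟨a, b⟩, ν⟩ h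
    simp [Fin.prod_univ_succ, mul_comm]

lemma auxS_zero (μ : ℕ) (hμ : 1 ≤ μ) : auxS μ 0 = 0 := by
  obtain ⟨k, rfl⟩ : ∃ k, μ = k + 1 := ⟨μ - 1, by omega⟩
  rw [auxS_succ]
  simp

lemma auxS_succ' (μ m : ℕ) (hμ : 1 ≤ μ) :
    auxS (μ + 1) (m + 1) =
      ∑ k ∈ Finset.range m, ((k : ℝ) + 1) ^ ((1 / 2 : ℝ) - 1) * auxS μ (m - k) := by
  rw [auxS_succ, Finset.Nat.sum_antidiagonal_eq_sum_range_succ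
    (fun a b => 1 / Real.sqrt (a : ℝ) * auxS μ b), Finset.sum_range_succ, Finset.sum_range_succ']
  simp only [Nat.sub_self, auxS_zero μ hμ]
  simp only [Nat.cast_zero, Real.sqrt_zero, div_zero, zero_mul, mul_zero, add_zero]
  apply Finset.sum_congr rfl
  intro k _
  rw [Nat.add_sub_add_right]
  congr 1
  rw [Real.sqrt_eq_rpow, one_div, ← Real.rpow_neg (by positivity)]
  push_cast
  norm_num

noncomputable def auxC (μ : ℕ) : ℝ := Real.pi ^ ((μ : ℝ) / 2) / Real.Gamma ((μ : ℝ) / 2)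

lemma auxC_pos (μ : ℕ) (hμ : 1 ≤ μ) : 0 < auxC μ := by
  unfold auxC
  have h : (0:ℝ) < (μ : ℝ) := by exact_mod_cast hμ
  have := Real.Gamma_pos_of_pos (half_pos h)
  have := Real.pi_pos
  positivity

lemma aux_step (μ : ℕ) (hμ : 1 ≤ μ)
    (ih : ∀ n : ℕ, 1 ≤ n → auxS μ n ≤ auxC μ * (n : ℝ) ^ ((μ : ℝ) / 2 - 1)) (n : ℕ) (hn : 1 ≤ n) :
    auxS (μ + 1) n < auxC (μ + 1) * (n : ℝ) ^ (((μ + 1 : ℕ) : ℝ) / 2 - 1) := by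
  obtain ⟨m, rfl⟩ : ∃ k, n = k + 1 := ⟨n - 1, by omega⟩
  have h0 : (0:ℝ) < (μ : ℝ) := by exact_mod_cast hμ
  have hs := aux_sum m ((μ : ℝ) / 2) (by
    rcases hμ.eq_or_lt with h | h
    · left; rw [← h]; norm_num
    · right
      have : (2:ℝ) ≤ μ := by exact_mod_cast h
      linarith)
  rw [auxS_succ' μ m hμ]
  have h1 : ∑ k ∈ Finset.range m, ((k : ℝ) + 1) ^ ((1 / 2 : ℝ) - 1) * auxS μ (m - k) ≤
      auxC μ * ∑ k ∈ Finset.range m, ((k : ℝ) + 1) ^ ((1 / 2 : ℝ) - 1) *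
        (((m : ℝ) + 1) - ((k : ℝ) + 1)) ^ ((μ : ℝ) / 2 - 1) := by
    rw [Finset.mul_sum]
    apply Finset.sum_le_sum
    intro k hk
    have hk := Finset.mem_range.mp hk
    have := ih (m - k) (by omega)
    rw [Nat.cast_sub hk.le] at this
    have e : (m : ℝ) + 1 - ((k : ℝ) + 1) = m - k := by ring
    rw [e, mul_left_comm]
    exact mul_le_mul_of_nonneg_left this (by positivity)
  refine h1.trans_lt ((mul_lt_mul_of_pos_left hs (auxC_pos μ hμ)).trans_eq ?_)
  unfold auxC
  have g1 := (Real.Gamma_pos_of_pos (half_pos h0)).ne'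
  have e1 : ((μ + 1 : ℕ) : ℝ) / 2 = 1 / 2 + (μ : ℝ) / 2 := by push_cast; ring
  have g2 := (Real.Gamma_pos_of_pos (show (0:ℝ) < 1 / 2 + (μ : ℝ) / 2 by positivity)).ne'
  rw [e1, Real.Gamma_one_half_eq, Real.rpow_add Real.pi_pos, Real.sqrt_eq_rpow]
  push_cast
  field_simp

lemma aux_main (μ : ℕ) (hμ : 1 ≤ μ) : ∀ n : ℕ, 1 ≤ n →
    auxS μ n ≤ auxC μ * (n : ℝ) ^ ((μ : ℝ) / 2 - 1) := by
  induction μ, hμ using Nat.le_induction with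
  | base =>
    intro n hn
    have : auxC 1 = 1 := by
      unfold auxC
      rw [Nat.cast_one, Real.Gamma_one_half_eq, Real.sqrt_eq_rpow]
      exact div_self (by have := Real.pi_pos; positivity)
    rw [this, one_mul]
    simp only [auxS, Finset.Nat.antidiagonalTuple_one, Finset.sum_singleton]
    simp only [Finset.univ_unique, Finset.prod_singleton]
    apply le_of_eq
    simp only [Fin.default_eq_zero, Matrix.cons_val_zero, Nat.cast_one]
    rw [Real.sqrt_eq_rpow, one_div, ← Real.rpow_neg (by positivity)]
    norm_num
  | succ μ hμ ih =>
    intro n hn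
    exact (aux_step μ hμ ih n hn).le

/-- For integers `μ ≥ 2` and `n ≥ 1`, the sum of `1/√(ν₁⋯ν_μ)` over all
tuples `ν ∈ ℕ^μ` with `ν₁+⋯+ν_μ = n` and all `νᵢ ≥ 1` is strictly less than
`(π^{μ/2}/Γ(μ/2))·n^{μ/2−1}`. -/
theorem stmt_5 (μ n : ℕ) (hμ : 2 ≤ μ) (hn : 1 ≤ n) :
    ∑ ν ∈ (Finset.Nat.antidiagonalTuple μ n).filter (fun ν => ∀ i, 1 ≤ ν i),
        1 / Real.sqrt (∏ i, (ν i : ℝ)) <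
      Real.pi ^ ((μ : ℝ) / 2) / Real.Gamma ((μ : ℝ) / 2) * (n : ℝ) ^ ((μ : ℝ) / 2 - 1) := by
  obtain ⟨k, rfl⟩ : ∃ k, μ = k + 1 := ⟨μ - 1, by omega⟩
  have h := aux_step k (by omega) (aux_main k (by omega)) n hn
  refine lt_of_le_of_lt ?_ h
  unfold auxS
  have e : ∀ ν : Fin (k + 1) → ℕ,
      1 / Real.sqrt (∏ i, (ν i : ℝ)) = ∏ i, (1 / Real.sqrt (ν i : ℝ)) := by
    intro ν
    rw [Real.sqrt_prod _ (fun i _ => Nat.cast_nonneg _)]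
    simp
  simp_rw [e]
  exact Finset.sum_le_sum_of_subset_of_nonneg (Finset.filter_subset _ _)
    (fun ν _ _ => Finset.prod_nonneg fun i _ => by positivity)
end

section
/- Fix an integer m ≥ 2, a real H* ≥ 0, and η > 0. Then for every integer n ≥ 100, the sum of #f over all f ∈ F_n with H(f) < (1−η)·H* is strictly less than 4.004·√(2π)·0.6^m·n^{(m−1)/2}·e^{n(1−η)H*}. -/
open BigOperators Finset

/-- coefficients `k^k/k!` -/
noncomputable def fc (k : ℕ) : ℝ := (k:ℝ)^k / (k.factorial : ℝ)
/-- tree function coefficients -/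
noncomputable def tc (k : ℕ) : ℝ := if k = 0 then 0 else (k:ℝ)^(k-1) / (k.factorial : ℝ)

lemma tc_inner_sum (s : ℕ) :
    ∑ p ∈ antidiagonal s, tc p.1 * ((-(p.1:ℝ))^p.2 / (p.2.factorial : ℝ)) = if s = 1 then 1 else 0 := by
  rcases s with _ | _ | s
  · simp [tc]
  · simp [tc, Finset.Nat.antidiagonal_succ]
  · have h := congrFun (fwdDiff_iter_pow_eq_zero_of_lt (R := ℝ) (j := s+1) (n := s+2) (by omega)) 0
    rw [fwdDiff_iter_eq_sum_shift] at h
    rw [Finset.Nat.sum_antidiagonal_eq_sum_range_succ_mk]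
    rw [if_neg (by omega)]
    have h2 : ∀ k ∈ range (s+2+1), tc k * ((-(k:ℝ))^(s+2-k) / ((s+2-k).factorial : ℝ)) =
      (1/((s+2).factorial:ℝ)) * (((-1 : ℤ) ^ (s+2 - k) * (s+2).choose k) • (0 + k • (1:ℝ))^(s+1)) := by
      intro k hk
      have hk' : k ≤ s+2 := by simpa [Nat.lt_succ_iff] using hk
      rcases Nat.eq_zero_or_pos k with rfl | hp
      · simp [tc]
      · rw [tc, if_neg (by omega), zsmul_eq_mul]
        push_cast
        rw [Nat.cast_choose ℝ hk']
        have : ((s+2).factorial:ℝ) ≠ 0 := by positivity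
        have : (k.factorial:ℝ) ≠ 0 := by positivity
        have : ((s+2-k).factorial:ℝ) ≠ 0 := by positivity
        have e : (k:ℝ)^(s+1) = (k:ℝ)^(k-1) * (k:ℝ)^(s+2-k) := by
          rw [← pow_add]; congr 1; omega
        rw [neg_pow (k:ℝ)]
        simp only [zero_add, nsmul_eq_mul, mul_one]
        rw [e]
        field_simp
    rw [Finset.sum_congr rfl h2, ← Finset.mul_sum, h]; simp

lemma abel (n : ℕ) : fc n = (if n = 0 then 1 else 0) + ∑ p ∈ antidiagonal n, tc p.1 * fc p.2 := by
  rcases Nat.eq_zero_or_pos n with rfl | hn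
  · simp [fc, tc]
  have h1 : ∀ p ∈ antidiagonal n, tc p.1 * fc p.2 =
      ∑ q ∈ antidiagonal p.2, ((n:ℝ)^q.1 / (q.1.factorial:ℝ)) *
        (tc p.1 * ((-(p.1:ℝ))^q.2 / (q.2.factorial : ℝ))) := by
    rintro ⟨i, j⟩ hp
    have hp : i + j = n := by simpa using hp
    have : (j:ℝ) = n + -(i:ℝ) := by rw [← hp]; push_cast; ring
    simp only [fc]
    conv_lhs => enter [2,1]; rw [this]
    rw [(Commute.all (n:ℝ) (-(i:ℝ))).add_pow', Finset.sum_div, Finset.mul_sum]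
    refine Finset.sum_congr rfl fun q hq => ?_
    have hq : q.1 + q.2 = j := by simpa using hq
    subst hq
    rw [nsmul_eq_mul, Nat.cast_add_choose]
    have : ((q.1+q.2).factorial:ℝ) ≠ 0 := by positivity
    field_simp
  rw [Finset.sum_congr rfl h1, if_neg hn.ne', zero_add]
  have h2 : ∑ p ∈ antidiagonal n, ∑ q ∈ antidiagonal p.2, ((n:ℝ)^q.1 / (q.1.factorial:ℝ)) *
        (tc p.1 * ((-(p.1:ℝ))^q.2 / (q.2.factorial : ℝ))) =
      ∑ p ∈ antidiagonal n, ∑ q ∈ antidiagonal p.2, ((n:ℝ)^p.1 / (p.1.factorial:ℝ)) *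
        (tc q.1 * ((-(q.1:ℝ))^q.2 / (q.2.factorial : ℝ))) := by
    rw [Finset.sum_sigma', Finset.sum_sigma']
    refine Finset.sum_nbij' (fun x => ⟨(x.2.1, x.1.1 + x.2.2), (x.1.1, x.2.2)⟩)
      (fun x => ⟨(x.2.1, x.1.1 + x.2.2), (x.1.1, x.2.2)⟩) ?_ ?_ ?_ ?_ ?_
    · rintro ⟨⟨a,b⟩,⟨c,d⟩⟩ h; simp at h ⊢; omega
    · rintro ⟨⟨a,b⟩,⟨c,d⟩⟩ h; simp at h ⊢; omega
    · rintro ⟨⟨a,b⟩,⟨c,d⟩⟩ h; simp at h ⊢; omega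
    · rintro ⟨⟨a,b⟩,⟨c,d⟩⟩ h; simp at h ⊢; omega
    · rintro ⟨⟨a,b⟩,⟨c,d⟩⟩ h; rfl
  rw [h2]
  simp_rw [← Finset.mul_sum, tc_inner_sum]
  rw [Finset.sum_eq_single (n-1, 1)]
  · obtain ⟨k, rfl⟩ : ∃ k, n = k+1 := ⟨n-1, by omega⟩
    simp [fc, Nat.factorial_succ, pow_succ]
    field_simp
  · rintro ⟨a,b⟩ h hne
    have h : a + b = n := by simpa using h
    rw [if_neg, mul_zero]
    rintro rfl
    apply hne
    ext <;> simp; omega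
  · intro h; exfalso; apply h; simp; omega

open PowerSeries in
/-- generating function -/
noncomputable def FS : PowerSeries ℝ := PowerSeries.mk fc
noncomputable def TS : PowerSeries ℝ := PowerSeries.mk tc

lemma FS_eq : FS = 1 + TS * FS := by
  ext n
  simp only [FS, TS, map_add, PowerSeries.coeff_mul, PowerSeries.coeff_mk, PowerSeries.coeff_one]
  exact abel n

open PowerSeries in
lemma theta_TS : (X : PowerSeries ℝ) * d⁄dX ℝ TS = FS - 1 := by
  ext n
  rcases n with _ | n
  · simp [FS, fc]
  · rw [coeff_succ_X_mul, coeff_derivative]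
    simp [FS, TS, fc, tc, coeff_one]
    rw [pow_succ]; ring

open PowerSeries in
lemma theta_FS : (X : PowerSeries ℝ) * d⁄dX ℝ FS = FS^3 - FS^2 := by
  have h1 : FS * (1 - TS) = 1 := by linear_combination FS_eq
  have h2 : d⁄dX ℝ FS = d⁄dX ℝ TS * FS + TS * d⁄dX ℝ FS := by
    conv_lhs => rw [FS_eq]
    rw [map_add, Derivation.leibniz, derivative_one]
    simp only [smul_eq_mul]; ring
  have h3 : d⁄dX ℝ FS = FS^2 * d⁄dX ℝ TS := by
    linear_combination (-d⁄dX ℝ FS) * h1 + FS * h2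
  rw [h3]
  linear_combination FS^2 * theta_TS

/-- coefficients of powers -/
noncomputable def ac (m n : ℕ) : ℝ := PowerSeries.coeff n (FS^m)

open PowerSeries in
lemma ac_rec (m n : ℕ) (hm : 1 ≤ m) : ac (m+2) n = ac (m+1) n + (n:ℝ)/m * ac m n := by
  have h : (X : PowerSeries ℝ) * d⁄dX ℝ (FS^m) = (m : PowerSeries ℝ) * (FS^(m+2) - FS^(m+1)) := by
    obtain ⟨k, rfl⟩ : ∃ k, m = k+1 := ⟨m-1, by omega⟩
    rw [derivative_pow]
    simp only [Nat.add_sub_cancel]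
    linear_combination (((k+1:ℕ):PowerSeries ℝ) * FS^k) * theta_FS
  have h2 := congrArg (coeff n) h
  have h3 : coeff n ((X : PowerSeries ℝ) * d⁄dX ℝ (FS^m)) = n * ac m n := by
    rcases n with _ | n
    · simp
    · rw [coeff_succ_X_mul, coeff_derivative, ac]; push_cast; ring
  rw [h3, ← nsmul_eq_mul (α := PowerSeries ℝ), map_nsmul, map_sub, nsmul_eq_mul] at h2
  change (n:ℝ) * ac m n = m * (ac (m+2) n - ac (m+1) n) at h2
  have : (m:ℝ) ≠ 0 := by positivity
  field_simp
  linarith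

lemma ac_one (n : ℕ) : ac 1 n = fc n := by simp [ac, FS]

lemma ac_two (n : ℕ) : ac 2 n = ∑ p ∈ antidiagonal n, fc p.1 * fc p.2 := by
  simp [ac, FS, pow_two, PowerSeries.coeff_mul]

lemma ac_tuple (m n : ℕ) : ac m n = ∑ ν ∈ Finset.Nat.antidiagonalTuple m n, ∏ i, fc (ν i) := by
  have : FS^m = ∏ _j ∈ (Finset.univ : Finset (Fin m)), FS := by simp
  rw [ac, this, PowerSeries.coeff_prod]
  refine Finset.sum_nbij' (fun l => ⇑l) (fun ν => Finsupp.equivFunOnFinite.symm ν) ?_ ?_ ?_ ?_ ?_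
  · intro l hl
    rw [Finset.mem_finsuppAntidiag] at hl
    rw [Finset.Nat.mem_antidiagonalTuple]; exact hl.1
  · intro ν hν
    rw [Finset.Nat.mem_antidiagonalTuple] at hν
    rw [Finset.mem_finsuppAntidiag]; exact ⟨hν, by simp⟩
  · intro l _; ext; rfl
  · intro l _; rfl
  · intro l _; simp [FS]

lemma fc_pos (n : ℕ) : 0 < fc n := by
  rcases Nat.eq_zero_or_pos n with rfl | hn
  · simp [fc]
  · unfold fc; positivity

lemma fc_le (k : ℕ) (hk : 1 ≤ k) : fc k ≤ Real.exp k / (Real.sqrt (2 * Real.pi) * Real.sqrt k) := by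
  have h := Stirling.le_factorial_stirling k
  have hk' : (0:ℝ) < k := by positivity
  rw [Real.sqrt_mul (by positivity), div_pow, ← Real.exp_nat_mul, mul_one] at h
  unfold fc
  rw [div_le_div_iff₀ (by positivity) (by positivity)]
  have : (k:ℝ)^k * (Real.sqrt (2 * Real.pi) * Real.sqrt k) = Real.exp k * (Real.sqrt (2 * Real.pi) * Real.sqrt k * ((k:ℝ)^k / Real.exp k)) := by
    field_simp
  rw [this]
  gcongr

lemma le_fc (n : ℕ) (hn : 1 ≤ n) : Real.exp n ≤ fc n * (Real.exp 1 * Real.sqrt n) := by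
  obtain ⟨k, rfl⟩ : ∃ k, n = k+1 := ⟨n-1, by omega⟩
  have h : Stirling.stirlingSeq (k+1) ≤ Stirling.stirlingSeq 1 := Stirling.stirlingSeq'_antitone (Nat.zero_le k)
  rw [Stirling.stirlingSeq_one, Stirling.stirlingSeq, Real.sqrt_mul (by norm_num), div_pow, ← Real.exp_nat_mul, mul_one] at h
  rw [div_le_div_iff₀ (by positivity) (by positivity)] at h
  unfold fc
  have hf : (0:ℝ) < (k+1).factorial := by positivity
  have h2 : (0:ℝ) < Real.sqrt 2 := by positivity
  have h' : ((k+1).factorial:ℝ) ≤ Real.exp 1 * (Real.sqrt (k+1:ℕ) * (((k+1:ℕ):ℝ)^(k+1) / Real.exp (k+1:ℕ))) := by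
    refine le_of_mul_le_mul_right ?_ h2
    linarith
  have e : Real.exp (k+1:ℕ) * (Real.exp 1 * (Real.sqrt (k+1:ℕ) * (((k+1:ℕ):ℝ)^(k+1) / Real.exp (k+1:ℕ)))) = Real.exp 1 * Real.sqrt (k+1:ℕ) * ((k+1:ℕ):ℝ)^(k+1) := by
    field_simp
  rw [div_mul_eq_mul_div, le_div_iff₀ hf]
  have := mul_le_mul_of_nonneg_left h' (Real.exp_pos (k+1:ℕ)).le
  linarith

lemma sum_inv_sqrt (n : ℕ) : ∑ k ∈ range (n+1), 1 / Real.sqrt k ≤ 2 * Real.sqrt n := by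
  induction n with
  | zero => simp
  | succ n ih =>
    rw [Finset.sum_range_succ]
    have h1 : Real.sqrt n ≤ Real.sqrt (n+1:ℕ) := Real.sqrt_le_sqrt (by push_cast; linarith)
    have h0 := Real.sqrt_nonneg n
    have hp : 0 < Real.sqrt (n+1:ℕ) := by positivity
    have e1 : Real.sqrt n ^ 2 = n := Real.sq_sqrt (by positivity)
    have e2 : Real.sqrt (n+1:ℕ) ^ 2 = n+1 := by rw [Real.sq_sqrt (by positivity)]; push_cast; rfl
    have : 1 / Real.sqrt (n+1:ℕ) ≤ 2 * Real.sqrt (n+1:ℕ) - 2 * Real.sqrt n := by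
      rw [div_le_iff₀ hp]
      nlinarith [sq_nonneg (Real.sqrt (n+1:ℕ) - Real.sqrt n)]
    linarith

lemma term_bound (n i j : ℕ) (h : i + j = n) :
    fc i * fc j ≤ ((if i = 0 then fc n else 0) + (if j = 0 then fc n else 0)) +
      Real.exp n / (2 * Real.pi * Real.sqrt n) * (1 / Real.sqrt i + 1 / Real.sqrt j) := by
  have hpos : 0 ≤ Real.exp n / (2 * Real.pi * Real.sqrt n) * (1 / Real.sqrt i + 1 / Real.sqrt j) := by positivity
  have hn := fc_pos n
  rcases Nat.eq_zero_or_pos i with rfl | hi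
  · have : j = n := by omega
    subst this
    have : fc 0 = 1 := by simp [fc]
    rw [this, if_pos (rfl : (0:ℕ) = 0)]
    split_ifs <;> linarith
  rcases Nat.eq_zero_or_pos j with rfl | hj
  · have : i = n := by omega
    subst this
    have : fc 0 = 1 := by simp [fc]
    rw [this, if_pos (rfl : (0:ℕ) = 0)]
    split_ifs <;> linarith
  rw [if_neg hi.ne', if_neg hj.ne', add_zero, zero_add]
  refine (mul_le_mul (fc_le i hi) (fc_le j hj) (fc_pos j).le (by positivity)).trans ?_
  have e : (Real.exp n) = Real.exp i * Real.exp j := by rw [← h, ← Real.exp_add]; push_cast; rfl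
  rw [e]
  have hsi : 0 < Real.sqrt i := by positivity
  have hsj : 0 < Real.sqrt j := by positivity
  have hsn : 0 < Real.sqrt n := by rw [← h]; positivity
  have hs : Real.sqrt n ≤ Real.sqrt i + Real.sqrt j := by
    rw [Real.sqrt_le_left (by positivity)]
    have e1 : Real.sqrt i ^ 2 = i := Real.sq_sqrt (by positivity)
    have e2 : Real.sqrt j ^ 2 = j := Real.sq_sqrt (by positivity)
    rw [← h]; push_cast
    nlinarith
  have ep : Real.sqrt (2 * Real.pi) * Real.sqrt (2 * Real.pi) = 2 * Real.pi := Real.mul_self_sqrt (by positivity)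
  have hpi := Real.pi_pos
  have : Real.exp i / (Real.sqrt (2 * Real.pi) * Real.sqrt i) * (Real.exp j / (Real.sqrt (2 * Real.pi) * Real.sqrt j))
     = (Real.exp i * Real.exp j / (2 * Real.pi * Real.sqrt n)) * (Real.sqrt n / (Real.sqrt i * Real.sqrt j)) := by
    have hq : 0 < Real.sqrt (2 * Real.pi) := by positivity
    generalize Real.sqrt (2 * Real.pi) = q at ep hq
    rw [← ep]; field_simp
  rw [this]
  have e3 : 1 / Real.sqrt i + 1 / Real.sqrt j = (Real.sqrt i + Real.sqrt j) / (Real.sqrt i * Real.sqrt j) := by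
    field_simp; ring
  rw [e3]
  gcongr

lemma ac_two_le (n : ℕ) (hn : 100 ≤ n) : ac 2 n ≤ fc n * (1.94 * Real.sqrt n) := by
  rw [ac_two]
  have h1 := Finset.sum_le_sum (s := antidiagonal n) fun p hp =>
    term_bound n p.1 p.2 (by simpa using hp)
  refine h1.trans ?_
  simp only [Finset.sum_add_distrib, ← Finset.mul_sum]
  have s1 : ∑ p ∈ antidiagonal n, (if p.1 = 0 then fc n else 0) = fc n := by
    rw [Finset.sum_eq_single (0, n)]
    · simp
    · rintro ⟨a,b⟩ h hne
      have h : a + b = n := by simpa using h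
      rw [if_neg]; rintro rfl; apply hne; ext <;> simp; omega
    · simp
  have s2 : ∑ p ∈ antidiagonal n, (if p.2 = 0 then fc n else 0) = fc n := by
    rw [← Finset.Nat.sum_antidiagonal_swap] ; exact s1
  have s3 : ∑ p ∈ antidiagonal n, 1 / Real.sqrt p.1 ≤ 2 * Real.sqrt n := by
    rw [Finset.Nat.sum_antidiagonal_eq_sum_range_succ_mk]; exact sum_inv_sqrt n
  have s4 : ∑ p ∈ antidiagonal n, 1 / Real.sqrt p.2 ≤ 2 * Real.sqrt n := by
    rw [← Finset.Nat.sum_antidiagonal_swap] ; exact s3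
  rw [s1, s2]
  have hr : 10 ≤ Real.sqrt n := by
    apply Real.le_sqrt_of_sq_le; norm_num; exact_mod_cast hn
  have hf := fc_pos n
  have hl := le_fc n (by omega)
  have he := Real.exp_one_lt_d9
  have hpi := Real.pi_gt_d2
  have a1 : Real.exp n / (2 * Real.pi * Real.sqrt n) * (∑ p ∈ antidiagonal n, 1 / Real.sqrt p.1 + ∑ p ∈ antidiagonal n, 1 / Real.sqrt p.2)
     ≤ Real.exp n / (2 * Real.pi * Real.sqrt n) * (4 * Real.sqrt n) := by
    gcongr; linarith
  have a2 : Real.exp n / (2 * Real.pi * Real.sqrt n) * (4 * Real.sqrt n) = 2 * Real.exp n / Real.pi := by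
    field_simp; ring
  have a3 : 2 * Real.exp n / Real.pi ≤ 1.74 * (fc n * Real.sqrt n) := by
    rw [div_le_iff₀ (by positivity)]
    have hq : 0 < fc n * Real.sqrt n := by positivity
    nlinarith
  nlinarith

/-- induction predicate -/
def PB (n k : ℕ) (C : ℝ) : Prop := ac (k+1) n ≤ C * (fc n * 0.6^(k+1) * Real.sqrt n ^ k)

lemma PB_step (n k : ℕ) (hn : 100 ≤ n) (A B C : ℝ) (hB : 0 ≤ B) (h1 : PB n k A) (h2 : PB n (k+1) B)
    (h : B / 6 + A / (0.36 * (k+1)) ≤ C) : PB n (k+2) C := by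
  unfold PB at *
  have hr : 10 ≤ Real.sqrt n := by
    apply Real.le_sqrt_of_sq_le; norm_num; exact_mod_cast hn
  have hf := fc_pos n
  have e2 : (n:ℝ) = Real.sqrt n ^ 2 := (Real.sq_sqrt (by positivity)).symm
  have hrec := ac_rec (k+1) n (by omega)
  set r := Real.sqrt n with hrd
  have hY : 0 < fc n * 0.6^(k+1) * r^k := by positivity
  set Y := fc n * 0.6^(k+1) * r^k with hYd
  have y1 : fc n * 0.6^(k+1+1) * r^(k+1) = Y * (0.6 * r) := by rw [hYd]; ring
  have y2 : fc n * 0.6^(k+2+1) * r^(k+2) = Y * (0.36 * r^2) := by rw [hYd]; ring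
  rw [y1] at h2
  rw [y2]
  have h3 : (n:ℝ)/((k+1:ℕ):ℝ) * ac (k+1) n ≤ (n:ℝ)/((k+1:ℕ):ℝ) * (A * Y) := by gcongr
  have h4 : B * (Y * (0.6 * r)) ≤ B/6 * (Y * (0.36 * r^2)) := by
    have : 0 ≤ B * Y * r := by positivity
    nlinarith
  have h5 : (n:ℝ)/((k+1:ℕ):ℝ) * (A * Y) = A / (0.36 * (k+1)) * (Y * (0.36 * r^2)) := by
    rw [e2]; push_cast; field_simp
  have h6 : (B / 6 + A / (0.36 * (k+1))) * (Y * (0.36 * r^2)) ≤ C * (Y * (0.36 * r^2)) := by gcongr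
  have h7 : ac (k+2+1) n = ac (k+1+1) n + (n:ℝ)/((k+1:ℕ):ℝ) * ac (k+1) n := hrec
  linarith

lemma PB_mono (n k : ℕ) (A B : ℝ) (h : A ≤ B) (h1 : PB n k A) : PB n k B := by
  have hf := fc_pos n
  unfold PB at *
  refine h1.trans ?_
  gcongr

lemma PB_all (n : ℕ) (hn : 100 ≤ n) (k : ℕ) : PB n k 9 := by
  have p0 : PB n 0 (5/3) := by
    unfold PB; rw [ac_one]; have := fc_pos n; norm_num; linarith
  have p1 : PB n 1 5.39 := by
    unfold PB
    have := ac_two_le n hn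
    have hq : 0 < fc n * Real.sqrt n := by have := fc_pos n; positivity
    norm_num at *; nlinarith
  have p2 : PB n 2 5.53 := PB_step n 0 hn _ _ _ (by norm_num) p0 p1 (by norm_num)
  have p3 : PB n 3 8.41 := PB_step n 1 hn _ _ _ (by norm_num) p1 p2 (by norm_num)
  have p4 : PB n 4 6.54 := PB_step n 2 hn _ _ _ (by norm_num) p2 p3 (by norm_num)
  have key : ∀ j, PB n (j+3) 9 ∧ PB n (j+4) 9 := by
    intro j
    induction j with
    | zero => exact ⟨PB_mono _ _ _ _ (by norm_num) p3, PB_mono _ _ _ _ (by norm_num) p4⟩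
    | succ j ih =>
      refine ⟨ih.2, PB_step n (j+3) hn 9 9 9 (by norm_num) ih.1 ih.2 ?_⟩
      have : (9:ℝ) / (0.36 * (((j+3:ℕ):ℝ)+1)) ≤ 9 / (0.36 * 4) := by
        gcongr; push_cast; linarith [Nat.cast_nonneg (α := ℝ) j]
      norm_num at this ⊢; linarith
  match k with
  | 0 => exact PB_mono _ _ _ _ (by norm_num) p0
  | 1 => exact PB_mono _ _ _ _ (by norm_num) p1
  | 2 => exact PB_mono _ _ _ _ (by norm_num) p2
  | j+3 => exact (key j).1

lemma multinomial_eq (m n : ℕ) (hn : 1 ≤ n) (ν : Fin m → ℕ) (hν : ∑ i, ν i = n) :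
    (Nat.multinomial Finset.univ ν : ℝ) = (∏ i, fc (ν i)) / fc n *
      Real.exp (n * -∑ i, ((ν i : ℝ) / n) * Real.log ((ν i : ℝ) / n)) := by
  have hn' : (0:ℝ) < n := by positivity
  have e0 : ∀ k : ℕ, Real.exp ((k:ℝ) * Real.log ((k:ℝ)/n)) = ((k:ℝ)/n)^k := by
    intro k
    rcases Nat.eq_zero_or_pos k with rfl | hk
    · simp
    · rw [Real.exp_nat_mul, Real.exp_log (by positivity)]
  have e1 : (n * -∑ i, ((ν i : ℝ) / n) * Real.log ((ν i : ℝ) / n)) = - ∑ i, (ν i : ℝ) * Real.log ((ν i : ℝ) / n) := by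
    rw [mul_neg, Finset.mul_sum]; congr 1
    refine Finset.sum_congr rfl fun i _ => ?_
    field_simp
  have hP : ∏ i, (ν i : ℝ)^(ν i) ≠ 0 := by
    rw [Finset.prod_ne_zero_iff]; intro i _
    rcases Nat.eq_zero_or_pos (ν i) with h | h
    · simp [h]
    · positivity
  have hF : ∏ i, ((ν i).factorial : ℝ) ≠ 0 := by
    rw [Finset.prod_ne_zero_iff]; intro i _; positivity
  rw [e1, Real.exp_neg, Real.exp_sum]
  simp_rw [e0, div_pow, fc]
  rw [Finset.prod_div_distrib, Finset.prod_div_distrib, Finset.prod_pow_eq_pow_sum, hν]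
  have hs := Nat.multinomial_spec Finset.univ ν
  rw [hν] at hs
  have hs' : (∏ i, ((ν i).factorial : ℝ)) * (Nat.multinomial Finset.univ ν : ℝ) = (n.factorial : ℝ) := by
    exact_mod_cast hs
  have : (n.factorial:ℝ) ≠ 0 := by positivity
  rw [← hs'] at this ⊢
  field_simp

theorem stmt_6 (m : ℕ) (hm : 2 ≤ m) (Hs : ℝ) (hHs : 0 ≤ Hs) (η : ℝ) (hη : 0 < η)
    (n : ℕ) (hn : 100 ≤ n) :
    (∑ ν ∈ (Finset.Nat.antidiagonalTuple m n).filter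
        (fun ν => -∑ i, ((ν i : ℝ) / n) * Real.log ((ν i : ℝ) / n) < (1 - η) * Hs),
        (Nat.multinomial Finset.univ ν : ℝ)) <
      4.004 * Real.sqrt (2 * Real.pi) * 0.6 ^ m * (n : ℝ) ^ (((m : ℝ) - 1) / 2) *
        Real.exp (n * ((1 - η) * Hs)) := by
  have hf := fc_pos n
  set E := Real.exp (n * ((1 - η) * Hs)) with hE
  have hEp : 0 < E := Real.exp_pos _
  have hn0 : (0:ℝ) < n := by exact_mod_cast (by omega : 0 < n)
  have h1 : (∑ ν ∈ (Finset.Nat.antidiagonalTuple m n).filter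
        (fun ν => -∑ i, ((ν i : ℝ) / n) * Real.log ((ν i : ℝ) / n) < (1 - η) * Hs),
        (Nat.multinomial Finset.univ ν : ℝ)) ≤ ac m n / fc n * E := by
    have hnn : ∀ ν : Fin m → ℕ, 0 ≤ (∏ i, fc (ν i)) / fc n := fun ν =>
      div_nonneg (Finset.prod_nonneg fun i _ => (fc_pos _).le) hf.le
    calc _ ≤ ∑ ν ∈ (Finset.Nat.antidiagonalTuple m n).filter
            (fun ν => -∑ i, ((ν i : ℝ) / n) * Real.log ((ν i : ℝ) / n) < (1 - η) * Hs),
          (∏ i, fc (ν i)) / fc n * E := by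
          refine Finset.sum_le_sum fun ν hν => ?_
          rw [Finset.mem_filter, Finset.Nat.mem_antidiagonalTuple] at hν
          rw [multinomial_eq m n (by omega) ν hν.1]
          refine mul_le_mul_of_nonneg_left ?_ (hnn ν)
          exact Real.exp_le_exp.mpr (mul_le_mul_of_nonneg_left hν.2.le hn0.le)
      _ ≤ ∑ ν ∈ Finset.Nat.antidiagonalTuple m n, (∏ i, fc (ν i)) / fc n * E :=
          Finset.sum_le_sum_of_subset_of_nonneg (Finset.filter_subset _ _)
            fun ν _ _ => mul_nonneg (hnn ν) hEp.le
      _ = _ := by rw [← Finset.sum_mul, ← Finset.sum_div, ac_tuple]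
  refine h1.trans_lt ?_
  refine mul_lt_mul_of_pos_right ?_ hEp
  obtain ⟨k, rfl⟩ : ∃ k, m = k+1 := ⟨m-1, by omega⟩
  have h2 : ac (k+1) n ≤ 9 * (fc n * 0.6^(k+1) * Real.sqrt n ^ k) := PB_all n hn k
  have e : (n : ℝ) ^ ((((k+1:ℕ) : ℝ) - 1) / 2) = Real.sqrt n ^ k := by
    rw [Real.sqrt_eq_rpow, ← Real.rpow_natCast, ← Real.rpow_mul hn0.le]
    congr 1; push_cast; ring
  rw [e, div_lt_iff₀ hf]
  refine h2.trans_lt ?_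
  have hs : 2.5 ≤ Real.sqrt (2 * Real.pi) := by
    apply Real.le_sqrt_of_sq_le; have := Real.pi_gt_d2; norm_num at *; linarith
  have hY : 0 < fc n * 0.6^(k+1) * Real.sqrt n ^ k := by
    have : 0 < Real.sqrt n := Real.sqrt_pos.mpr hn0
    positivity
  have : 4.004 * Real.sqrt (2 * Real.pi) * 0.6 ^ (k+1) * Real.sqrt n ^ k * fc n = 4.004 * Real.sqrt (2 * Real.pi) * (fc n * 0.6^(k+1) * Real.sqrt n ^ k) := by ring
  rw [this]
  refine mul_lt_mul_of_pos_right ?_ hY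
  linarith
end

section
/- Let φ* ∈ ℝ^m (m ≥ 2) be a probability vector with μ* ≥ 1 nonzero entries, largest entry φ*_max and smallest nonzero entry φ*_min. Let θ > 0 satisfy θ ≤ φ*_max and, if μ* ≥ 2, also θ ≤ (μ*−1)·φ*_min. Then for every integer n ≥ 1 the set {f ∈ F_n : ‖f − φ*‖∞ ≤ θ} contains at least Λ(n,θ,μ*) elements, where Λ(n,θ,μ*) = ⌊nθ·(1/(m−1) + 1/(μ*−1))⌋^{μ*−1}·⌊nθ/(m−1)⌋^{m−μ*} when μ* ≥ 2, and Λ(n,θ,1) = ⌊nθ/(m−1)⌋^{m−1}. -/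
open BigOperators Finset

lemma window_card (a l u : ℝ) (h : l ≤ a) (hu : 0 ≤ u) (hl : 0 ≤ l) :
    ⌊l + u⌋₊ ≤ (Finset.Icc ⌈a - l⌉₊ ⌊a + u⌋₊).card := by
  rw [Nat.card_Icc]
  have h1 : (⌈a - l⌉₊ : ℝ) < a - l + 1 := Nat.ceil_lt_add_one (by linarith)
  have h2 : a + u < (⌊a + u⌋₊ : ℝ) + 1 := Nat.lt_floor_add_one _
  have h3 : (⌊l + u⌋₊ : ℝ) ≤ l + u := Nat.floor_le (by linarith)
  have h4 : ⌊l + u⌋₊ + ⌈a - l⌉₊ < ⌊a + u⌋₊ + 1 + 1 := by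
    have : (⌊l + u⌋₊ : ℝ) + ⌈a - l⌉₊ < ⌊a + u⌋₊ + 1 + 1 := by linarith
    exact_mod_cast this
  omega

/-- Lower bound `Λ(n,θ,μ*)` on the number of frequency vectors in `F_n`
within ℓ∞ distance `θ` of the probability vector `φ*`, where `μ*` is the number of
nonzero entries of `φ*`, `θ ≤ φ*_max`, and (if `μ* ≥ 2`) `θ ≤ (μ*−1)·φ*_min`. -/
theorem stmt_7 (m : ℕ) (hm : 2 ≤ m) (φ : Fin m → ℝ)
    (hφ0 : ∀ i, 0 ≤ φ i) (hφ1 : ∑ i, φ i = 1)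
    (μ : ℕ) (hμ : μ = (Finset.univ.filter fun i => φ i ≠ 0).card) (hμ1 : 1 ≤ μ)
    (φmax φmin : ℝ)
    (hmax : (∃ i, φ i = φmax) ∧ ∀ i, φ i ≤ φmax)
    (hmin : (∃ i, φ i ≠ 0 ∧ φ i = φmin) ∧ ∀ i, φ i ≠ 0 → φmin ≤ φ i)
    (θ : ℝ) (hθ0 : 0 < θ) (hθmax : θ ≤ φmax)
    (hθmin : 2 ≤ μ → θ ≤ ((μ : ℝ) - 1) * φmin)
    (n : ℕ) (hn : 1 ≤ n)
    (Λ : ℕ)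
    (hΛ : Λ = if 2 ≤ μ then
        ⌊(n : ℝ) * θ * (1 / ((m : ℝ) - 1) + 1 / ((μ : ℝ) - 1))⌋₊ ^ (μ - 1) *
          ⌊(n : ℝ) * θ / ((m : ℝ) - 1)⌋₊ ^ (m - μ)
      else ⌊(n : ℝ) * θ / ((m : ℝ) - 1)⌋₊ ^ (m - 1)) :
    Λ ≤ ((Finset.Nat.antidiagonalTuple m n).filter
        (fun ν => ∀ i, |(ν i : ℝ) / n - φ i| ≤ θ)).card := by
  obtain ⟨⟨i0, hi0⟩, hmx⟩ := hmax
  obtain ⟨⟨j0, hj0, hj0'⟩, hmn⟩ := hmin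
  have hn0 : (0 : ℝ) < n := by exact_mod_cast hn
  have hφi0 : φ i0 ≠ 0 := by
    rw [hi0]; exact ne_of_gt (lt_of_lt_of_le hθ0 hθmax)
  set t : ℝ := n * θ with ht
  have ht0 : 0 < t := mul_pos hn0 hθ0
  have hm1 : (1 : ℝ) ≤ (m : ℝ) - 1 := by
    have : (2 : ℝ) ≤ m := by exact_mod_cast hm
    linarith
  have hμr : (0 : ℝ) ≤ (μ : ℝ) - 1 := by
    have : (1 : ℝ) ≤ μ := by exact_mod_cast hμ1
    linarith
  set u : ℝ := t / ((m : ℝ) - 1) with hu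
  have hu0 : 0 ≤ u := by positivity
  set v : ℝ := t / ((μ : ℝ) - 1) with hv
  have hv0 : 0 ≤ v := by positivity
  have hut : u ≤ t := div_le_self ht0.le hm1
  have hmu : ((m : ℝ) - 1) * u = t := by rw [hu]; field_simp
  have hvt : v ≤ t := by
    by_cases h2 : 2 ≤ μ
    · have : (2 : ℝ) ≤ μ := by exact_mod_cast h2
      exact div_le_self ht0.le (by linarith)
    · have : μ = 1 := by omega
      rw [hv, this]; simp [ht0.le]
  have hmv : ((μ : ℝ) - 1) * v ≤ t := by
    by_cases h2 : 2 ≤ μ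
    · have : (2 : ℝ) ≤ μ := by exact_mod_cast h2
      have : (μ : ℝ) - 1 ≠ 0 := by linarith
      rw [hv]; apply le_of_eq; field_simp
    · have : μ = 1 := by omega
      rw [this]; simp [ht0.le]
  let l : Fin m → ℝ := fun i => if φ i = 0 then 0 else v
  have hl0 : ∀ i, 0 ≤ l i := by
    intro i; simp only [l]; split_ifs <;> simp [hv0]
  have hlt : ∀ i, l i ≤ t := by
    intro i; simp only [l]; split_ifs
    · exact ht0.le
    · exact hvt
  have hla : ∀ i, l i ≤ n * φ i := by
    intro i; simp only [l]; split_ifs with h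
    · simp [h]
    · by_cases h2 : 2 ≤ μ
      · have h3 : (2 : ℝ) ≤ μ := by exact_mod_cast h2
        have h4 := hθmin h2
        have h5 := hmn i h
        rw [hv, div_le_iff₀ (by linarith), ht]
        have : θ ≤ ((μ : ℝ) - 1) * φ i := h4.trans (mul_le_mul_of_nonneg_left h5 hμr)
        calc (n : ℝ) * θ ≤ n * (((μ : ℝ) - 1) * φ i) := mul_le_mul_of_nonneg_left this hn0.le
          _ = _ := by ring
      · have : μ = 1 := by omega
        rw [hv, this]; simp; exact mul_nonneg hn0.le (hφ0 i)
  -- counting facts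
  have hcardS : ((univ.erase i0).filter fun i => ¬ φ i = 0).card = μ - 1 := by
    rw [Finset.filter_erase, Finset.card_erase_of_mem (by simp [hφi0]), hμ]
  have hcardE : (univ.erase i0).card = m - 1 := by
    rw [Finset.card_erase_of_mem (mem_univ _)]; simp
  have hcardZ : ((univ.erase i0).filter fun i => φ i = 0).card = m - μ := by
    have := Finset.card_filter_add_card_filter_not (s := univ.erase i0) (fun i => φ i = 0)
    omega
  let W : Fin m → Finset ℕ := fun i =>
    if i = i0 then {0} else Finset.Icc ⌈n * φ i - l i⌉₊ ⌊n * φ i + u⌋₊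
  have hΛ' : Λ = ∏ i ∈ univ.erase i0, ⌊l i + u⌋₊ := by
    have e1 : ∏ i ∈ univ.erase i0, ⌊l i + u⌋₊
        = ∏ i ∈ univ.erase i0, if φ i = 0 then ⌊u⌋₊ else ⌊v + u⌋₊ := by
      apply Finset.prod_congr rfl
      intro i _
      simp only [l]; split_ifs <;> simp
    rw [e1, Finset.prod_ite, Finset.prod_const, Finset.prod_const, hcardS, hcardZ, hΛ]
    split_ifs with h2
    · rw [mul_comm]
      congr 3
      rw [hu, hv]; ring
    · have : μ = 1 := by omega
      subst this; simp
  have hcard : Λ ≤ (Fintype.piFinset W).card := by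
    rw [Fintype.card_piFinset, ← Finset.mul_prod_erase univ _ (mem_univ i0), hΛ']
    simp only [W, if_true, card_singleton, one_mul]
    apply Finset.prod_le_prod'
    intro i hi
    rw [if_neg (Finset.ne_of_mem_erase hi)]
    exact window_card _ _ _ (hla i) hu0 (hl0 i)
  refine hcard.trans ?_
  apply Finset.card_le_card_of_injOn
    (fun f => Function.update f i0 (n - ∑ i ∈ univ.erase i0, f i))
  · intro f hf
    have hf := Fintype.mem_piFinset.1 (Finset.mem_coe.1 hf)
    have hlow : ∀ i ∈ univ.erase i0, n * φ i - l i ≤ f i := by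
      intro i hi
      have := hf i
      simp only [W, if_neg (Finset.ne_of_mem_erase hi), Finset.mem_Icc] at this
      exact Nat.ceil_le.1 this.1
    have hup : ∀ i ∈ univ.erase i0, (f i : ℝ) ≤ n * φ i + u := by
      intro i hi
      have := hf i
      simp only [W, if_neg (Finset.ne_of_mem_erase hi), Finset.mem_Icc] at this
      exact (Nat.le_floor_iff (add_nonneg (mul_nonneg hn0.le (hφ0 i)) hu0)).1 this.2
    have hφs : ∑ i ∈ univ.erase i0, (n : ℝ) * φ i = n - n * φ i0 := by
      rw [← Finset.mul_sum]
      have := Finset.add_sum_erase univ φ (mem_univ i0)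
      rw [hφ1] at this
      have h6 : ∑ i ∈ univ.erase i0, φ i = 1 - φ i0 := by linarith
      rw [h6]; ring
    have hls : ∑ i ∈ univ.erase i0, l i ≤ t := by
      simp only [l]
      rw [Finset.sum_ite, Finset.sum_const, Finset.sum_const, hcardS]
      simp only [nsmul_eq_mul, mul_zero, zero_add]
      rw [Nat.cast_sub hμ1]; simpa using hmv
    have hus : ∑ i ∈ univ.erase i0, u = t := by
      rw [Finset.sum_const, hcardE, nsmul_eq_mul, Nat.cast_sub (by omega)]
      simpa using hmu
    have hS1 := Finset.sum_le_sum hlow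
    have hS2 := Finset.sum_le_sum hup
    rw [Finset.sum_sub_distrib, hφs] at hS1
    rw [Finset.sum_add_distrib, hφs, hus] at hS2
    have hti : t ≤ n * φ i0 := by
      rw [hi0]; exact mul_le_mul_of_nonneg_left hθmax hn0.le
    have hSn : ∑ i ∈ univ.erase i0, f i ≤ n := by
      have : ∑ i ∈ univ.erase i0, (f i : ℝ) ≤ n := by linarith
      exact_mod_cast this
    have key : ∀ (x : ℕ) (i : Fin m), n * φ i - t ≤ x → (x : ℝ) ≤ n * φ i + t →
        |(x : ℝ) / n - φ i| ≤ θ := by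
      intro x i h1 h2
      have e : (x : ℝ) / n - φ i = (x - n * φ i) / n := by field_simp
      rw [e, abs_div, abs_of_pos hn0, div_le_iff₀ hn0, abs_le]
      constructor <;> linarith
    simp only [Finset.coe_filter, Set.mem_ofPred_eq, Finset.Nat.mem_antidiagonalTuple]
    constructor
    · rw [← Finset.add_sum_erase univ _ (mem_univ i0), Function.update_self]
      have : ∑ i ∈ univ.erase i0, Function.update f i0 (n - ∑ i ∈ univ.erase i0, f i) i
          = ∑ i ∈ univ.erase i0, f i := by
        apply Finset.sum_congr rfl
        intro i hi
        rw [Function.update_of_ne (Finset.ne_of_mem_erase hi)]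
      rw [this]; omega
    · intro i
      by_cases hi : i = i0
      · subst hi
        rw [Function.update_self]
        apply key
        · rw [Nat.cast_sub hSn]; push_cast; linarith
        · rw [Nat.cast_sub hSn]; push_cast; linarith
      · rw [Function.update_of_ne hi]
        have hi' : i ∈ univ.erase i0 := by simp [hi]
        apply key
        · have := hlow i hi'; have := hlt i; linarith
        · have := hup i hi'; linarith
  · intro f hf g hg hfg
    have hf := Fintype.mem_piFinset.1 (Finset.mem_coe.1 hf) i0
    have hg := Fintype.mem_piFinset.1 (Finset.mem_coe.1 hg) i0
    simp only [W, if_true, Finset.mem_singleton] at hf hg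
    funext i
    by_cases hi : i = i0
    · rw [hi, hf, hg]
    · have := congrFun hfg i
      simpa [Function.update_of_ne hi] using this
end

section
/- Assume every entry of φ* is strictly positive, with smallest entry φ*_min, and H* > 0. Let δ = (δ⁼, δ^≤, δ⁼⁰, δ^≤⁰) be positive tolerances, ε > 0, η > 0, and α ∈ (0,1) with m/(α·η·H*) ≥ 21; set θ₀ = min(θ∞, (2/3)·α·η·H*/ln(m/(α·η·H*))) and assume θ₀ < φ*_min. Define C₁ = (m−1)/((1−α)ηH*) and C₂ = (m·ln 0.6 + (0.5·ln(2π) + 1/12 − 0.5·ln m)·m + ln((1/ε + 1)/0.249))/((1−α)ηH*). Then for every integer n with n ≥ 100, n ≥ C₁·ln n + C₂, and n ≥ (m−1)/(2θ₀): #A_n(δ,η)/(#A_n(δ,η) + #B_n(δ,η)) ≥ 1 − ε, where A_n(δ,η) = {f ∈ F_n ∩ C(δ) : H(f) ≥ (1−η)H*} and B_n(δ,η) = {f ∈ F_n ∩ C(δ) : H(f) < (1−η)H*}. -/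
open scoped Classical
open BigOperators Finset

/-- Minimum absolute value of the entries of a vector `b`. -/
noncomputable def bAbsMin {k : ℕ} (b : Fin (k + 1) → ℝ) : ℝ := ⨅ i, |b i|

/-- Matrix infinity norm: maximum over rows of the sum of absolute values. -/
noncomputable def rowNorm {k m : ℕ} (A : Matrix (Fin (k + 1)) (Fin m) ℝ) : ℝ :=
  ⨆ i, ∑ j, |A i j|

/-- `x` satisfies the constraints to accuracy `δ = (deq, dle, deq0, dle0)`,
i.e. `x ∈ C(δ)`. -/
def InC {m ke kle ke0 kle0 : ℕ}
    (Aeq : Matrix (Fin (ke + 1)) (Fin m) ℝ) (beq : Fin (ke + 1) → ℝ)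
    (Ale : Matrix (Fin (kle + 1)) (Fin m) ℝ) (ble : Fin (kle + 1) → ℝ)
    (Aeq0 : Matrix (Fin (ke0 + 1)) (Fin m) ℝ)
    (Ale0 : Matrix (Fin (kle0 + 1)) (Fin m) ℝ)
    (deq dle deq0 dle0 : ℝ) (x : Fin m → ℝ) : Prop :=
  (∀ i, |Aeq.mulVec x i - beq i| ≤ deq * bAbsMin beq) ∧
  (∀ i, Ale.mulVec x i - ble i ≤ dle * bAbsMin ble) ∧
  (∀ i, |Aeq0.mulVec x i| ≤ deq0) ∧
  (∀ i, Ale0.mulVec x i ≤ dle0)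

/-- `x` satisfies the constraints exactly. -/
def ExactSat {m ke kle ke0 kle0 : ℕ}
    (Aeq : Matrix (Fin (ke + 1)) (Fin m) ℝ) (beq : Fin (ke + 1) → ℝ)
    (Ale : Matrix (Fin (kle + 1)) (Fin m) ℝ) (ble : Fin (kle + 1) → ℝ)
    (Aeq0 : Matrix (Fin (ke0 + 1)) (Fin m) ℝ)
    (Ale0 : Matrix (Fin (kle0 + 1)) (Fin m) ℝ)
    (x : Fin m → ℝ) : Prop :=
  Aeq.mulVec x = beq ∧ (∀ i, Ale.mulVec x i ≤ ble i) ∧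
  Aeq0.mulVec x = 0 ∧ (∀ i, Ale0.mulVec x i ≤ 0)

/-- The tolerance `θ∞` of Proposition 2. -/
noncomputable def thetaInf {m ke kle ke0 kle0 : ℕ}
    (Aeq : Matrix (Fin (ke + 1)) (Fin m) ℝ) (beq : Fin (ke + 1) → ℝ)
    (Ale : Matrix (Fin (kle + 1)) (Fin m) ℝ) (ble : Fin (kle + 1) → ℝ)
    (Aeq0 : Matrix (Fin (ke0 + 1)) (Fin m) ℝ)
    (Ale0 : Matrix (Fin (kle0 + 1)) (Fin m) ℝ)
    (deq dle deq0 dle0 : ℝ) : ℝ :=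
  min (min (deq * bAbsMin beq / rowNorm Aeq) (dle * bAbsMin ble / rowNorm Ale))
      (min (deq0 / rowNorm Aeq0) (dle0 / rowNorm Ale0))


noncomputable def ecT : PowerSeries ℝ := PowerSeries.mk fun k => (k : ℝ) ^ k / (k.factorial : ℝ)
noncomputable def ecW : PowerSeries ℝ :=
  PowerSeries.mk fun k => (k : ℝ) ^ k / (k : ℝ) / (k.factorial : ℝ)

lemma ec_expand (g : ℕ → ℝ) (n : ℕ) :
    ∑ k ∈ range (n + 1), g k / (k.factorial : ℝ) *
        (((n - k : ℕ) : ℝ) ^ (n - k) / ((n - k).factorial : ℝ)) =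
    ∑ j ∈ range (n + 1), (n : ℝ) ^ j / (j.factorial : ℝ) *
      ∑ k ∈ range (n - j + 1), g k / (k.factorial : ℝ) *
        ((-(k : ℝ)) ^ (n - j - k) / ((n - j - k).factorial : ℝ)) := by
  have h1 : ∀ k ∈ range (n + 1), g k / (k.factorial : ℝ) *
        (((n - k : ℕ) : ℝ) ^ (n - k) / ((n - k).factorial : ℝ)) =
      ∑ j ∈ range (n - k + 1), (n : ℝ) ^ j / (j.factorial : ℝ) * (g k / (k.factorial : ℝ) *
        ((-(k : ℝ)) ^ (n - j - k) / ((n - j - k).factorial : ℝ))) := by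
    intro k hk
    have hk' : k ≤ n := by simpa [Nat.lt_succ_iff] using hk
    rw [Nat.cast_sub hk', sub_eq_add_neg, add_pow, Finset.sum_div, Finset.mul_sum]
    refine Finset.sum_congr rfl fun j hj => ?_
    have hj' : j ≤ n - k := by simpa [Nat.lt_succ_iff] using hj
    rw [Nat.sub_right_comm n j k, Nat.cast_choose ℝ hj']
    have := Nat.factorial_ne_zero (n - k)
    field_simp
  rw [Finset.sum_congr rfl h1]
  simp_rw [Finset.mul_sum]
  apply Finset.sum_comm'
  intro x y
  simp only [mem_range]
  omega

lemma ec_diff (N p : ℕ) :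
    ∑ k ∈ range (N + 1), (-1 : ℝ) ^ (N - k) * (N.choose k : ℝ) * (k : ℝ) ^ p =
      (fwdDiff (1 : ℝ))^[N] (fun x => x ^ p) 0 := by
  rw [fwdDiff_iter_eq_sum_shift]
  refine Finset.sum_congr rfl fun k hk => ?_
  simp

lemma ec_inner1 (N : ℕ) :
    ∑ k ∈ range (N + 1), (k : ℝ) ^ k / (k.factorial : ℝ) *
        ((-(k : ℝ)) ^ (N - k) / ((N - k).factorial : ℝ)) = 1 := by
  have h := ec_diff N N
  rw [fwdDiff_iter_eq_factorial] at h
  have hN : (N.factorial : ℝ) ≠ 0 := by exact_mod_cast Nat.factorial_ne_zero N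
  have : ∑ k ∈ range (N + 1), (k : ℝ) ^ k / (k.factorial : ℝ) *
        ((-(k : ℝ)) ^ (N - k) / ((N - k).factorial : ℝ)) = (∑ k ∈ range (N + 1), (-1 : ℝ) ^ (N - k) * (N.choose k : ℝ) * (k : ℝ) ^ N) / N.factorial := by
    rw [Finset.sum_div]
    refine Finset.sum_congr rfl fun k hk => ?_
    have hk' : k ≤ N := by simpa [Nat.lt_succ_iff] using hk
    rw [Nat.cast_choose ℝ hk', neg_pow]
    have e : (k : ℝ) ^ N = (k : ℝ) ^ k * (k : ℝ) ^ (N - k) := by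
      rw [← pow_add]; congr 1; omega
    rw [e]
    field_simp
  rw [this, h]
  simp [hN]

lemma ec_inner2 (N : ℕ) :
    ∑ k ∈ range (N + 1), (k : ℝ) ^ k / (k : ℝ) / (k.factorial : ℝ) *
        ((-(k : ℝ)) ^ (N - k) / ((N - k).factorial : ℝ)) = if N = 1 then 1 else 0 := by
  rcases Nat.lt_or_ge N 2 with h2 | h2
  · interval_cases N
    · simp
    · simp [Finset.sum_range_succ]
  have h := ec_diff N (N - 1)
  rw [fwdDiff_iter_pow_eq_zero_of_lt (by omega)] at h
  have hN : (N.factorial : ℝ) ≠ 0 := by exact_mod_cast Nat.factorial_ne_zero N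
  have : ∑ k ∈ range (N + 1), (k : ℝ) ^ k / (k : ℝ) / (k.factorial : ℝ) *
        ((-(k : ℝ)) ^ (N - k) / ((N - k).factorial : ℝ)) = (∑ k ∈ range (N + 1), (-1 : ℝ) ^ (N - k) * (N.choose k : ℝ) * (k : ℝ) ^ (N - 1)) / N.factorial := by
    rw [Finset.sum_div]
    refine Finset.sum_congr rfl fun k hk => ?_
    have hk' : k ≤ N := by simpa [Nat.lt_succ_iff] using hk
    rcases Nat.eq_zero_or_pos k with rfl | hk0
    · have : (0:ℝ) ^ (N - 1) = 0 := zero_pow (by omega)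
      simp [this]
    rw [Nat.cast_choose ℝ hk', neg_pow]
    have hkr : (k : ℝ) ≠ 0 := by positivity
    have e : (k : ℝ) ^ (N - 1) = (k : ℝ) ^ k / k * (k : ℝ) ^ (N - k) := by
      rw [div_mul_eq_mul_div, ← pow_add, eq_div_iff hkr, ← pow_succ]; congr 1; omega
    rw [e]
    field_simp
  rw [this, h, if_neg (by omega)]
  simp

lemma ec_coeff_sq (n : ℕ) :
    PowerSeries.coeff n (ecT ^ 2) = ∑ j ∈ range (n + 1), (n : ℝ) ^ j / (j.factorial : ℝ) := by
  rw [pow_two, PowerSeries.coeff_mul, Finset.Nat.sum_antidiagonal_eq_sum_range_succ_mk]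
  simp only [ecT, PowerSeries.coeff_mk]
  rw [ec_expand (fun k => (k : ℝ) ^ k)]
  refine Finset.sum_congr rfl fun j hj => ?_
  rw [ec_inner1, mul_one]

lemma ec_TW : ecT = 1 + ecT * ecW := by
  ext n
  rw [mul_comm, map_add, PowerSeries.coeff_mul, Finset.Nat.sum_antidiagonal_eq_sum_range_succ_mk]
  simp only [ecT, ecW, PowerSeries.coeff_mk, PowerSeries.coeff_one]
  rw [ec_expand (fun k => (k : ℝ) ^ k / (k : ℝ))]
  simp_rw [ec_inner2]
  rcases n with _ | n
  · simp
  · rw [Finset.sum_eq_single n]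
    · simp [Nat.factorial_succ, pow_succ]
      field_simp
    · intro b hb hbn
      simp only [mem_range] at hb
      rw [if_neg (by omega), mul_zero]
    · simp

lemma ec_XW : PowerSeries.X * PowerSeries.derivative ℝ ecW = ecT - 1 := by
  ext n
  rcases n with _ | n
  · simp [ecT]
  · rw [PowerSeries.coeff_succ_X_mul, PowerSeries.coeff_derivative]
    simp only [ecT, ecW, PowerSeries.coeff_mk, PowerSeries.coeff_one, map_sub]
    simp
    field_simp

lemma ec_XT : PowerSeries.X * PowerSeries.derivative ℝ ecT = ecT ^ 3 - ecT ^ 2 := by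
  have h := congrArg (PowerSeries.derivative ℝ) ec_TW
  rw [map_add, Derivation.leibniz] at h
  simp only [smul_eq_mul, PowerSeries.derivative_one, zero_add] at h
  have h1 := ec_TW
  have h2 := ec_XW
  set T' := PowerSeries.derivative ℝ ecT
  set W' := PowerSeries.derivative ℝ ecW
  linear_combination (PowerSeries.X * ecT) * h + ecT ^ 2 * h2 - PowerSeries.X * T' * h1

lemma ec_rec (n k : ℕ) (hk : 1 ≤ k) :
    (n : ℝ) * PowerSeries.coeff n (ecT ^ k) =
      k * (PowerSeries.coeff n (ecT ^ (k + 2)) - PowerSeries.coeff n (ecT ^ (k + 1))) := by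
  have h : PowerSeries.X * PowerSeries.derivative ℝ (ecT ^ k) =
      (k : ℝ) • (ecT ^ (k + 2) - ecT ^ (k + 1)) := by
    obtain ⟨k, rfl⟩ : ∃ l, k = l + 1 := ⟨k - 1, by omega⟩
    rw [PowerSeries.derivative_pow]
    have := ec_XT
    simp only [Nat.add_sub_cancel]
    rw [Nat.cast_smul_eq_nsmul, nsmul_eq_mul]
    linear_combination ((k + 1 : ℕ) : PowerSeries ℝ) * ecT ^ k * this
  have h2 := congrArg (PowerSeries.coeff n) h
  rw [PowerSeries.coeff_smul] at h2
  simp only [map_sub, smul_eq_mul] at h2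
  rw [← h2]
  rcases n with _ | n
  · simp
  · rw [PowerSeries.coeff_succ_X_mul, PowerSeries.coeff_derivative]; push_cast; ring

lemma ec_coeff_pow (m n : ℕ) :
    PowerSeries.coeff n (ecT ^ m) =
      ∑ ν ∈ Finset.Nat.antidiagonalTuple m n, ∏ i, ((ν i : ℝ) ^ (ν i) / ((ν i).factorial : ℝ)) := by
  have : ecT ^ m = ∏ i : Fin m, ecT := by simp
  rw [this, PowerSeries.coeff_prod]
  refine Finset.sum_nbij (fun l => ⇑l) ?_ ?_ ?_ ?_
  · intro l hl
    rw [Finset.mem_finsuppAntidiag] at hl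
    exact Finset.Nat.mem_antidiagonalTuple.2 hl.1
  · intro a _ b _ h
    exact DFunLike.coe_injective h
  · intro ν hν
    refine ⟨Finsupp.equivFunOnFinite.symm ν, ?_, rfl⟩
    simp only [Finset.mem_coe, Finset.mem_finsuppAntidiag]
    exact ⟨Finset.Nat.mem_antidiagonalTuple.1 hν, by simp⟩
  · intro l _
    simp [ecT]

/-- Shtarkov sum -/
noncomputable def ecD (n m : ℕ) : ℝ := (n.factorial : ℝ) / (n : ℝ) ^ n * PowerSeries.coeff n (ecT ^ m)

lemma ecD_one (n : ℕ) (hn : 0 < n) : ecD n 1 = 1 := by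
  simp [ecD, ecT]
  field_simp

lemma ecD_rec (n k : ℕ) (hk : 1 ≤ k) : ecD n (k + 2) = ecD n (k + 1) + n / k * ecD n k := by
  have h := ec_rec n k hk
  have hk' : (k : ℝ) ≠ 0 := by positivity
  unfold ecD
  have : PowerSeries.coeff n (ecT ^ (k + 2)) = PowerSeries.coeff n (ecT ^ (k + 1)) + n / k * PowerSeries.coeff n (ecT ^ k) := by
    field_simp
    linarith
  rw [this]; ring

lemma ecD_two (n : ℕ) (hn : 100 ≤ n) : ecD n 2 ≤ 2.1 * Real.sqrt n := by
  set p : ℕ → ℝ := fun j => (n.factorial : ℝ) / (n : ℝ) ^ n * ((n : ℝ) ^ (n - j) / ((n - j).factorial : ℝ)) with hp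
  have hn0 : (0 : ℝ) < n := by positivity
  have hD : ecD n 2 = ∑ j ∈ range (n + 1), p j := by
    rw [ecD, ec_coeff_sq, Finset.mul_sum, ← Finset.sum_range_reflect]
    refine Finset.sum_congr rfl fun j hj => ?_
    simp [hp]
  have hp0 : ∀ j, 0 ≤ p j := fun j => by positivity
  have hpz : p 0 = 1 := by
    simp only [hp, Nat.sub_zero]; field_simp
  have hstep : ∀ j, j < n → p (j + 1) = p j - (j : ℝ) * p j / n := by
    intro j hj
    obtain ⟨t, ht⟩ : ∃ t, n - j = t + 1 := ⟨n - j - 1, by omega⟩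
    have ht' : n - (j + 1) = t := by omega
    have hj' : (j : ℝ) = n - (t + 1) := by
      have : n = j + (t + 1) := by omega
      have : (n : ℝ) = j + (t + 1) := by exact_mod_cast this
      linarith
    simp only [hp, ht, ht', hj', Nat.factorial_succ, pow_succ]
    push_cast
    field_simp
    ring
  have hp1 : ∀ j, j ≤ n → p j ≤ 1 := by
    intro j
    induction j with
    | zero => intro _; exact hpz.le
    | succ j ih =>
      intro hj
      rw [hstep j (by omega)]
      have := ih (by omega)
      have h2 : 0 ≤ (j : ℝ) * p j / n := by have := hp0 j; positivity
      linarith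
  have htel : ∀ N, N ≤ n → ∑ j ∈ range N, (j : ℝ) * p j = n * (1 - p N) := by
    intro N
    induction N with
    | zero => intro _; simp [hpz]
    | succ N ih =>
      intro hN
      rw [Finset.sum_range_succ, ih (by omega), hstep N (by omega)]
      field_simp
      ring
  have htot : ∑ j ∈ range (n + 1), (j : ℝ) * p j = n := by
    rw [Finset.sum_range_succ, htel n le_rfl]; ring
  set s := Real.sqrt n with hs
  have hs10 : 10 ≤ s := by
    apply Real.le_sqrt_of_sq_le
    have : (100 : ℝ) ≤ n := by exact_mod_cast hn
    linarith
  have hss : s * s = n := Real.mul_self_sqrt hn0.le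
  have hterm : ∀ j ∈ range (n + 1), p j ≤ (j : ℝ) * p j / s + if j ∈ range (Nat.sqrt n + 1) then 1 else 0 := by
    intro j hj
    have hj' : j ≤ n := by simpa [Nat.lt_succ_iff] using hj
    split_ifs with h
    · have := hp1 j hj'
      have h2 : 0 ≤ (j : ℝ) * p j / s := by have := hp0 j; positivity
      linarith
    · simp only [mem_range, not_lt] at h
      have h3 : n < j * j := Nat.sqrt_lt.1 (by omega)
      have h4 : s ≤ j := by
        rw [hs]; apply Real.sqrt_le_iff.2 ⟨by positivity, ?_⟩
        have : n ≤ j ^ 2 := by nlinarith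
        exact_mod_cast this
      rw [add_zero, le_div_iff₀ (by positivity)]
      nlinarith [hp0 j]
  have hsum := Finset.sum_le_sum hterm
  rw [Finset.sum_add_distrib, ← Finset.sum_div, htot, Finset.sum_ite_mem] at hsum
  have hcard : ((range (n + 1) ∩ range (Nat.sqrt n + 1)).card : ℝ) ≤ s + 1 := by
    have h1 : (range (n + 1) ∩ range (Nat.sqrt n + 1)).card ≤ Nat.sqrt n + 1 := by
      calc _ ≤ (range (Nat.sqrt n + 1)).card := Finset.card_le_card Finset.inter_subset_right
        _ = _ := by simp
    have h2 : (Nat.sqrt n : ℝ) ≤ s := Real.nat_sqrt_le_real_sqrt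
    have h3 : ((range (n + 1) ∩ range (Nat.sqrt n + 1)).card : ℝ) ≤ (Nat.sqrt n : ℝ) + 1 := by exact_mod_cast h1
    linarith
  have hns : (n : ℝ) / s = s := by rw [div_eq_iff (by positivity)]; exact hss.symm
  rw [hD]
  simp only [sum_const, nsmul_eq_mul, mul_one] at hsum
  rw [hns] at hsum
  linarith

lemma ecD_bound (n : ℕ) (hn : 100 ≤ n) (m : ℕ) (hm : 1 ≤ m) :
    ecD n m * Real.sqrt n ≤ 10.06 * (0.6 * Real.sqrt n) ^ m := by
  have hn0 : (0 : ℝ) < n := by positivity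
  have hD1 := ecD_one n (by omega)
  have hD2 := ecD_two n hn
  have hrec := ecD_rec n
  set s := Real.sqrt n with hs
  have hs10 : 10 ≤ s := by
    apply Real.le_sqrt_of_sq_le
    have : (100 : ℝ) ≤ n := by exact_mod_cast hn
    linarith
  have hss : (n : ℝ) = s * s := (Real.mul_self_sqrt hn0.le).symm
  rw [hss] at hrec
  obtain ⟨r, hr⟩ : ∃ r, r = 0.6 * s := ⟨_, rfl⟩
  have hsr : s = r / 0.6 := by rw [hr]; ring
  have hr6 : 6 ≤ r := by rw [hr]; linarith
  rw [← hr]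
  set d : ℕ → ℝ := fun m => ecD n m * s with hd
  have hdrec : ∀ k, 1 ≤ k → d (k + 2) = d (k + 1) + r ^ 2 / (0.36 * k) * d k := by
    intro k hk
    simp only [hd]
    rw [hrec k hk, hsr]
    have : (k : ℝ) ≠ 0 := by positivity
    field_simp
    ring
  have hr0 : 0 < r := by linarith
  have up : ∀ k c, 0 ≤ c → d k ≤ c * r ^ k → d k ≤ c / 6 * r ^ (k + 1) := by
    intro k c hc h
    refine h.trans ?_
    rw [pow_succ]
    have : 0 < r ^ k := by positivity
    nlinarith [mul_nonneg hc this.le]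
  have step : ∀ k c c', 1 ≤ k → 0 ≤ c → 0 ≤ c' → d k ≤ c * r ^ k → d (k + 1) ≤ c' * r ^ (k + 1) →
      d (k + 2) ≤ (c' / 6 + c / (0.36 * k)) * r ^ (k + 2) := by
    intro k c c' hk hc hc' h h'
    rw [hdrec k hk]
    have h1 := up (k + 1) c' hc' h'
    have hk0 : (0 : ℝ) < k := by positivity
    have h2 : r ^ 2 / (0.36 * k) * d k ≤ r ^ 2 / (0.36 * k) * (c * r ^ k) := by gcongr
    calc _ ≤ c' / 6 * r ^ (k + 2) + r ^ 2 / (0.36 * k) * (c * r ^ k) := add_le_add h1 h2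
      _ = _ := by rw [pow_add r k 2]; ring
  have weak : ∀ k c c', d k ≤ c * r ^ k → c ≤ c' → d k ≤ c' * r ^ k := by
    intro k c c' h hc
    exact h.trans (by gcongr)
  have d1 : d 1 ≤ 1.67 * r ^ 1 := by
    simp only [hd, hD1, hsr]; linarith
  have d2 : d 2 ≤ 5.84 * r ^ 2 := by
    simp only [hd]
    have : ecD n 2 * s ≤ 2.1 * s * s := by gcongr
    rw [hr]; nlinarith
  have d3 : d 3 ≤ 5.7 * r ^ 3 := weak _ _ _ (step 1 _ _ le_rfl (by norm_num) (by norm_num) d1 d2) (by norm_num)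
  have d4 : d 4 ≤ 10 * r ^ 4 := weak _ _ _ (step 2 _ _ (by norm_num) (by norm_num) (by norm_num) d2 d3) (by norm_num)
  have d5 : d 5 ≤ 10 * r ^ 5 := weak _ _ _ (step 3 _ _ (by norm_num) (by norm_num) (by norm_num) d3 d4) (by norm_num)
  have main : ∀ k, d (k + 4) ≤ 10 * r ^ (k + 4) ∧ d (k + 5) ≤ 10 * r ^ (k + 5) := by
    intro k
    induction k with
    | zero => exact ⟨d4, d5⟩
    | succ k ih =>
      refine ⟨?_, ?_⟩
      · have := ih.2
        rwa [show k + 1 + 4 = k + 5 by ring]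
      · have := step (k + 4) 10 10 (by omega) (by norm_num) (by norm_num) ih.1 ih.2
        refine weak _ _ _ this ?_
        have hk : (4 : ℝ) ≤ ((k + 4 : ℕ) : ℝ) := by push_cast; linarith [Nat.cast_nonneg (α := ℝ) k]
        have : 10 / (0.36 * ((k + 4 : ℕ) : ℝ)) ≤ 10 / (0.36 * 4) := by gcongr
        have h3 : (10 : ℝ) / (0.36 * 4) ≤ 7 := by norm_num
        linarith
  change d m ≤ _
  rcases Nat.lt_or_ge m 4 with h | h
  · interval_cases m
    · exact weak _ _ _ d1 (by norm_num)
    · exact weak _ _ _ d2 (by norm_num)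
    · exact weak _ _ _ d3 (by norm_num)
  · obtain ⟨k, rfl⟩ : ∃ k, m = k + 4 := ⟨m - 4, by omega⟩
    exact weak _ _ _ (main k).1 (by norm_num)

lemma ec_fact_upper (k : ℕ) (hk : 1 ≤ k) :
    Real.log (k.factorial : ℝ) ≤
      0.5 * Real.log (2 * Real.pi) + 0.5 * Real.log k + k * Real.log k - k + 1 / 12 := by
  have h1 : Real.log (Stirling.stirlingSeq k) ≤ Real.log (Stirling.stirlingSeq 1) := by
    have := Stirling.log_stirlingSeq'_antitone (Nat.zero_le (k - 1))
    simpa [Nat.succ_eq_add_one, Nat.sub_add_cancel hk] using this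
  rw [Stirling.log_stirlingSeq_formula, Stirling.log_stirlingSeq_formula] at h1
  have hk0 : (0 : ℝ) < k := by positivity
  rw [Real.log_div hk0.ne' (Real.exp_pos 1).ne', Real.log_mul two_ne_zero hk0.ne', Real.log_exp] at h1
  have h3 : (11 : ℝ) / 6 ≤ Real.log (2 * Real.pi) := by
    have hpi := Real.pi_gt_d6
    have he := Real.exp_one_lt_d9
    rw [Real.le_log_iff_exp_le (by positivity)]
    have h4 : (Real.exp (11 / 6)) ^ 6 ≤ (2 * Real.pi) ^ 6 := by
      rw [← Real.exp_nat_mul]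
      have : ((6 : ℕ) : ℝ) * (11 / 6) = (11 : ℕ) * 1 := by norm_num
      rw [this, Real.exp_nat_mul]
      calc Real.exp 1 ^ 11 ≤ 2.7182818286 ^ 11 := by gcongr
        _ ≤ (2 * 3.141592) ^ 6 := by norm_num
        _ ≤ _ := by gcongr
    exact le_of_pow_le_pow_left₀ (by norm_num) (by positivity) h4
  simp at h1
  linarith

lemma ec_fact_lower (n : ℕ) (hn : 1 ≤ n) :
    0.5 * Real.log (2 * Real.pi) + 0.5 * Real.log n + n * Real.log n - n ≤ Real.log (n.factorial : ℝ) := by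
  have h := Stirling.le_log_factorial_stirling (n := n) (by omega)
  have hn0 : (0 : ℝ) < n := by positivity
  linarith

/-- Lower bound of a multinomial coefficient. -/
lemma ec_multi_lower (m n : ℕ) (hm : 1 ≤ m) (hn : 1 ≤ n) (ν : Fin m → ℕ) (hν : ∑ i, ν i = n)
    (hpos : ∀ i, 1 ≤ ν i) :
    n * (-∑ i, ((ν i : ℝ) / n) * Real.log ((ν i : ℝ) / n)) + 0.5 * Real.log (2 * Real.pi)
      + 0.5 * Real.log n - m * (0.5 * Real.log (2 * Real.pi) + 1 / 12)
      - 0.5 * m * (Real.log n - Real.log m)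
      ≤ Real.log (Nat.multinomial Finset.univ ν : ℝ) := by
  have hn0 : (0 : ℝ) < n := by positivity
  have hm0 : (0 : ℝ) < m := by positivity
  have hν0 : ∀ i, (0 : ℝ) < ν i := fun i => by have := hpos i; positivity
  have hνs : ∑ i, (ν i : ℝ) = n := by exact_mod_cast hν
  have hmul : Real.log (Nat.multinomial Finset.univ ν : ℝ) =
      Real.log (n.factorial : ℝ) - ∑ i, Real.log ((ν i).factorial : ℝ) := by
    have h := Nat.multinomial_spec Finset.univ ν
    rw [hν] at h
    have h' : (∏ i, ((ν i).factorial : ℝ)) * (Nat.multinomial Finset.univ ν : ℝ) = n.factorial := by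
      exact_mod_cast h
    rw [← h', Real.log_mul, Real.log_prod]
    · ring
    · intro i _; positivity
    · exact Finset.prod_ne_zero_iff.2 fun i _ => by positivity
    · have := Nat.multinomial_pos Finset.univ ν; positivity
  have hH : n * (-∑ i, ((ν i : ℝ) / n) * Real.log ((ν i : ℝ) / n)) =
      n * Real.log n - ∑ i, (ν i : ℝ) * Real.log (ν i) := by
    have : ∀ i, ((ν i : ℝ) / n) * Real.log ((ν i : ℝ) / n) =
        ((ν i : ℝ) * Real.log (ν i) - (ν i : ℝ) * Real.log n) / n := by
      intro i
      rw [Real.log_div (hν0 i).ne' hn0.ne']; ring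
    simp_rw [this]
    rw [← Finset.sum_div, Finset.sum_sub_distrib, ← Finset.sum_mul, hνs]
    field_simp
    ring
  have hup : ∑ i, Real.log ((ν i).factorial : ℝ) ≤
      m * (0.5 * Real.log (2 * Real.pi) + 1 / 12) + 0.5 * ∑ i, Real.log (ν i)
        + ∑ i, (ν i : ℝ) * Real.log (ν i) - n := by
    calc _ ≤ ∑ i, ((0.5 * Real.log (2 * Real.pi) + 1 / 12) + 0.5 * Real.log (ν i) + ν i * Real.log (ν i) - ν i) :=
          Finset.sum_le_sum fun i _ => by linarith [ec_fact_upper (ν i) (hpos i)]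
      _ = _ := by
          rw [Finset.sum_sub_distrib, Finset.sum_add_distrib, Finset.sum_add_distrib, hνs, ← Finset.mul_sum]
          simp
          ring
  have hlow := ec_fact_lower n hn
  have hamgm : ∑ i, Real.log (ν i) ≤ m * (Real.log n - Real.log m) := by
    have : ∀ i, Real.log (ν i) ≤ (Real.log n - Real.log m) + ((ν i : ℝ) * (m / n) - 1) := by
      intro i
      have h := Real.log_le_sub_one_of_pos (x := (ν i : ℝ) * (m / n)) (by have := hν0 i; positivity)
      rw [Real.log_mul (hν0 i).ne' (by positivity), Real.log_div hm0.ne' hn0.ne'] at h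
      linarith
    calc _ ≤ ∑ i, ((Real.log n - Real.log m) + ((ν i : ℝ) * (m / n) - 1)) := Finset.sum_le_sum fun i _ => this i
      _ = _ := by
        rw [Finset.sum_add_distrib, Finset.sum_sub_distrib (fun i => (ν i : ℝ) * (m / n)), ← Finset.sum_mul, hνs]
        simp
        field_simp
        simp
  rw [hmul, hH]
  linarith

/-- Rounding. -/
lemma ec_round (m n : ℕ) (hm : 2 ≤ m) (x : Fin m → ℝ) (hx : ∑ i, x i = n)
    (hxl : ∀ i, ((m : ℝ) - 1) / 2 < x i) :
    ∃ ν : Fin m → ℕ, ∑ i, ν i = n ∧ (∀ i, 1 ≤ ν i) ∧ ∀ i, |x i - ν i| ≤ ((m : ℝ) - 1) / m := by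
  have hm2 : (2 : ℝ) ≤ m := by exact_mod_cast hm
  obtain ⟨i0⟩ : Nonempty (Fin m) := ⟨⟨0, by omega⟩⟩
  have hne : (Finset.Nat.antidiagonalTuple m n).Nonempty :=
    ⟨Pi.single i0 n, Finset.Nat.mem_antidiagonalTuple.2 (by simp)⟩
  obtain ⟨ν, hν, hmin⟩ := Finset.exists_min_image _ (fun ν : Fin m → ℕ => ∑ i, (x i - ν i) ^ 2) hne
  have hν' := Finset.Nat.mem_antidiagonalTuple.1 hν
  have hνs : ∑ i, (ν i : ℝ) = n := by exact_mod_cast hν'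
  have hes : ∑ i, (x i - ν i) = 0 := by rw [Finset.sum_sub_distrib, hx, hνs, sub_self]
  have hex : ∀ i j, 1 ≤ ν j → (x i - ν i) - (x j - ν j) ≤ 1 := by
    intro i j hj
    by_cases hij : i = j
    · subst hij; linarith
    set μ : Fin m → ℕ := Function.update (Function.update ν i (ν i + 1)) j (ν j - 1) with hμ
    have hμi : μ i = ν i + 1 := by simp [hμ, Function.update_of_ne hij]
    have hμj : μ j = ν j - 1 := by simp [hμ]
    have hμo : ∀ k, k ≠ i → k ≠ j → μ k = ν k := by
      intro k h1 h2; simp [hμ, Function.update_of_ne h1, Function.update_of_ne h2]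
    have split : ∀ f : Fin m → ℝ, ∑ k, f k = f i + f j + ∑ k ∈ (univ.erase i).erase j, f k := by
      intro f
      rw [← Finset.add_sum_erase univ f (mem_univ i),
        ← Finset.add_sum_erase (univ.erase i) f (a := j) (by simp [Ne.symm hij])]
      ring
    have rest : ∀ g : ℝ → ℝ → ℝ, ∑ k ∈ (univ.erase i).erase j, g (x k) (μ k) = ∑ k ∈ (univ.erase i).erase j, g (x k) (ν k) := by
      intro g
      refine Finset.sum_congr rfl fun k hk => ?_
      simp at hk
      rw [hμo k hk.2 hk.1]
    have hμjr : (μ j : ℝ) = ν j - 1 := by rw [hμj]; push_cast [hj]; ring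
    have hμir : (μ i : ℝ) = ν i + 1 := by rw [hμi]; push_cast; ring
    have hμs : ∑ k, (μ k : ℝ) = n := by
      rw [split, rest (fun _ b => b), hμjr, hμir, ← hνs, split (fun k => (ν k : ℝ))]; ring
    have hμm : μ ∈ Finset.Nat.antidiagonalTuple m n :=
      Finset.Nat.mem_antidiagonalTuple.2 (by exact_mod_cast hμs)
    have h := hmin μ hμm
    rw [split, split (fun k => (x k - μ k) ^ 2), rest (fun a b => (a - b) ^ 2), hμjr, hμir] at h
    nlinarith
  have hcard : ∀ c : ℝ, ∑ _i : Fin m, c = m * c := by intro c; simp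
  have avg : ∀ i (f : Fin m → ℝ), (∀ j, j ≠ i → f j ≤ 1) → f i ≤ 0 → ∑ j, f j ≤ (m : ℝ) - 1 := by
    intro i f h1 h2
    rw [← Finset.add_sum_erase univ f (mem_univ i)]
    have : ∑ j ∈ univ.erase i, f j ≤ ∑ j ∈ univ.erase i, (1 : ℝ) :=
      Finset.sum_le_sum fun j hj => h1 j (by simpa using hj)
    have hc : ((univ.erase i).card : ℝ) = (m : ℝ) - 1 := by
      rw [Finset.card_erase_of_mem (mem_univ i)]
      simp
      rw [Nat.cast_sub (by omega)]; simp
    simp only [sum_const, nsmul_eq_mul, mul_one, hc] at this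
    linarith
  have hpos : ∀ i, 1 ≤ ν i := by
    by_contra hcon
    push Not at hcon
    obtain ⟨i1, hi1⟩ := hcon
    obtain ⟨j, hj, hjmin⟩ := Finset.exists_min_image (univ.filter fun i => ν i = 0) (fun i => x i - ν i)
      ⟨i1, by simp; omega⟩
    simp only [mem_filter, mem_univ, true_and] at hj hjmin
    have h := avg j (fun i => (x j - ν j) - (x i - ν i)) (by
      intro i _
      by_cases hi : ν i = 0
      · have := hjmin i hi; linarith
      · exact hex j i (by omega)) (by simp)
    rw [Finset.sum_sub_distrib, hcard, hes, hj] at h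
    have := hxl j
    push_cast at h
    nlinarith
  refine ⟨ν, hν', hpos, fun i => ?_⟩
  rw [abs_le]
  have h1 := avg i (fun j => (x i - ν i) - (x j - ν j)) (fun j _ => hex i j (hpos j)) (by simp)
  have h2 := avg i (fun j => (x j - ν j) - (x i - ν i)) (fun j _ => hex j i (hpos i)) (by simp)
  rw [Finset.sum_sub_distrib, hcard, hes] at h1 h2
  have hm0 : (0 : ℝ) < m := by linarith
  constructor
  · rw [← neg_div, div_le_iff₀ hm0]; linarith
  · rw [le_div_iff₀ hm0]; linarith

lemma ec_log_num (L : ℝ) (hL : Real.log 21 ≤ L) : Real.log (1.5 * L) ≤ L / 2 := by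
  have h21 : Real.log 21 ≤ 3.055 := by
    rw [Real.log_le_iff_le_exp (by norm_num)]
    have he := Real.exp_one_gt_d9
    have h1 : (3.055 : ℝ) = (3 : ℕ) * 1 + 0.055 := by norm_num
    rw [h1, Real.exp_add, Real.exp_nat_mul]
    have h2 := Real.add_one_le_exp (0.055 : ℝ)
    calc (21 : ℝ) ≤ 2.7182818283 ^ 3 * (0.055 + 1) := by norm_num
      _ ≤ _ := by gcongr
  have h21' : (3 : ℝ) ≤ Real.log 21 := by
    rw [Real.le_log_iff_exp_le (by norm_num)]
    have he := Real.exp_one_lt_d9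
    have h1 : (3 : ℝ) = (3 : ℕ) * 1 := by norm_num
    rw [h1, Real.exp_nat_mul]
    calc _ ≤ (2.7182818286 : ℝ) ^ 3 := by gcongr
      _ ≤ _ := by norm_num
  have hL3 : 3 ≤ L := by linarith
  have hlog : Real.log (1.5 * L) ≤ Real.log (1.5 * 3.055) + (L / 3.055 - 1) := by
    have : 1.5 * L = (1.5 * 3.055) * (L / 3.055) := by ring
    rw [this, Real.log_mul (by norm_num) (by positivity)]
    have := Real.log_le_sub_one_of_pos (x := L / 3.055) (by positivity)
    linarith
  have hn : Real.log (1.5 * 3.055) ≤ Real.log 21 / 2 := by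
    have : Real.log 21 / 2 = Real.log (Real.sqrt 21) := (Real.log_sqrt (by norm_num)).symm
    rw [this]
    apply Real.log_le_log (by norm_num)
    apply Real.le_sqrt_of_sq_le; norm_num
  by_cases h : L ≤ 3.055
  · have : Real.log (1.5 * L) ≤ Real.log (1.5 * 3.055) := Real.log_le_log (by positivity) (by linarith)
    linarith
  · have : L / 3.055 - 1 ≤ (L - 3.055) / 2 := by
      have : L / 3.055 - 1 = (L - 3.055) / 3.055 := by ring
      rw [this]
      apply div_le_div_of_nonneg_left <;> linarith
    linarith

/-- Entropy continuity. -/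
lemma ec_entropy (m : ℕ) (hm : 2 ≤ m) (φ f : Fin m → ℝ) (hφ : ∀ i, 0 < φ i)
    (hφ1 : ∑ i, φ i = 1) (hf : ∀ i, 0 < f i) (hf1 : ∑ i, f i = 1)
    (hdf : ∀ i, φ i - f i ≤ f i) (a : ℝ) (ha : 0 < a) (h21 : 21 ≤ (m : ℝ) / a)
    (hd : ∑ i, |φ i - f i| ≤ 2 * ((2 / 3) * a / Real.log ((m : ℝ) / a))) :
    (-∑ i, φ i * Real.log (φ i)) - a ≤ -∑ i, f i * Real.log (f i) := by
  have hm0 : (0 : ℝ) < m := by positivity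
  set L := Real.log ((m : ℝ) / a) with hLdef
  have hL : Real.log 21 ≤ L := Real.log_le_log (by norm_num) h21
  have hL1 : 1 ≤ L := by
    have : (1 : ℝ) ≤ Real.log 21 := by
      rw [Real.le_log_iff_exp_le (by norm_num)]
      linarith [Real.exp_one_lt_d9]
    linarith
  have hnum := ec_log_num L hL
  set θ := (2 / 3) * a / L with hθ
  have hθ0 : 0 < θ := by positivity
  set c := θ / m with hc
  have hc0 : 0 < c := by positivity
  have hlc : -Real.log c = L + Real.log (1.5 * L) := by
    rw [← Real.log_inv, hLdef, ← Real.log_mul (by positivity) (by positivity)]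
    congr 1
    rw [hc, hθ]
    rw [← hLdef]
    field_simp
    norm_num
  have hlc1 : 1 ≤ -Real.log c := by
    rw [hlc]
    have : 0 ≤ Real.log (1.5 * L) := Real.log_nonneg (by linarith)
    linarith
  -- Gibbs
  have hfle : ∀ i, f i ≤ 1 := fun i => by
    rw [← hf1]; exact Finset.single_le_sum (fun j _ => (hf j).le) (mem_univ i)
  have hterm : ∀ i, -(φ i * Real.log (φ i)) + f i * Real.log (f i) ≤
      (f i - φ i) + (max (φ i - f i) 0 * (-Real.log c - 1) + c) := by
    intro i
    have h1 : φ i * (Real.log (f i) - Real.log (φ i)) ≤ f i - φ i := by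
      rw [← Real.log_div (hf i).ne' (hφ i).ne']
      have := Real.log_le_sub_one_of_pos (div_pos (hf i) (hφ i))
      have h2 := mul_le_mul_of_nonneg_left this (hφ i).le
      have h3 : φ i * (f i / φ i - 1) = f i - φ i := by
        have := (hφ i).ne'
        field_simp
      linarith
    have hlf : Real.log (f i) ≤ 0 := Real.log_nonpos (hf i).le (hfle i)
    have h2 : (φ i - f i) * (-Real.log (f i)) ≤ max (φ i - f i) 0 * (-Real.log c - 1) + c := by
      have h4 : (φ i - f i) * (-Real.log (f i)) ≤ max (φ i - f i) 0 * (-Real.log (f i)) :=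
        mul_le_mul_of_nonneg_right (le_max_left _ _) (by linarith)
      have h5 : -Real.log (f i) ≤ -Real.log c - 1 + c / f i := by
        have := Real.log_le_sub_one_of_pos (div_pos hc0 (hf i))
        rw [Real.log_div hc0.ne' (hf i).ne'] at this
        linarith
      have h6 : max (φ i - f i) 0 * (-Real.log (f i)) ≤ max (φ i - f i) 0 * (-Real.log c - 1 + c / f i) :=
        mul_le_mul_of_nonneg_left h5 (le_max_right _ _)
      have h7 : max (φ i - f i) 0 * (c / f i) ≤ f i * (c / f i) :=
        mul_le_mul_of_nonneg_right (max_le (hdf i) (hf i).le) (div_pos hc0 (hf i)).le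
      have h8 : f i * (c / f i) = c := by have := (hf i).ne'; field_simp
      linarith
    linarith
  have hsum := Finset.sum_le_sum fun i (_ : i ∈ univ) => hterm i
  rw [Finset.sum_add_distrib, Finset.sum_add_distrib, Finset.sum_add_distrib, ← Finset.sum_mul,
    Finset.sum_sub_distrib, hf1, hφ1, Finset.sum_neg_distrib] at hsum
  have hmax : ∑ i, max (φ i - f i) 0 ≤ θ := by
    have : ∀ i, max (φ i - f i) 0 = ((φ i - f i) + |φ i - f i|) / 2 := by
      intro i
      rcases le_total 0 (φ i - f i) with h | h
      · rw [max_eq_left h, abs_of_nonneg h]; ring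
      · rw [max_eq_right h, abs_of_nonpos h]; ring
    simp_rw [this]
    rw [← Finset.sum_div, Finset.sum_add_distrib, Finset.sum_sub_distrib, hf1, hφ1]
    linarith
  have hcs : ∑ _i : Fin m, c = θ := by
    simp [hc]; field_simp
  rw [hcs] at hsum
  have h9 : (∑ i, max (φ i - f i) 0) * (-Real.log c - 1) ≤ θ * (-Real.log c - 1) :=
    mul_le_mul_of_nonneg_right hmax (by linarith)
  have h10 : θ * (-Real.log c) ≤ a := by
    rw [hlc]
    have : θ * (L + Real.log (1.5 * L)) ≤ θ * (1.5 * L) := mul_le_mul_of_nonneg_left (by linarith) hθ0.le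
    have h2 : θ * (1.5 * L) = a := by rw [hθ]; field_simp; norm_num
    linarith
  linarith

lemma ec_nH (m n : ℕ) (hn : 1 ≤ n) (ν : Fin m → ℕ) (hν : ∑ i, ν i = n) :
    n * (-∑ i, ((ν i : ℝ) / n) * Real.log ((ν i : ℝ) / n)) =
      n * Real.log n - ∑ i, (ν i : ℝ) * Real.log (ν i) := by
  have hn0 : (0 : ℝ) < n := by positivity
  have hνs : ∑ i, (ν i : ℝ) = n := by exact_mod_cast hν
  have : ∀ i, ((ν i : ℝ) / n) * Real.log ((ν i : ℝ) / n) =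
      ((ν i : ℝ) * Real.log (ν i) - (ν i : ℝ) * Real.log n) / n := by
    intro i
    rcases Nat.eq_zero_or_pos (ν i) with h | h
    · simp [h]
    have : (ν i : ℝ) ≠ 0 := by positivity
    rw [Real.log_div this hn0.ne']; ring
  simp_rw [this]
  rw [← Finset.sum_div, Finset.sum_sub_distrib, ← Finset.sum_mul, hνs]
  field_simp
  ring

lemma ec_multi_eq (m n : ℕ) (hn : 1 ≤ n) (ν : Fin m → ℕ) (hν : ∑ i, ν i = n) :
    (Nat.multinomial Finset.univ ν : ℝ) =
      (n.factorial : ℝ) / (n : ℝ) ^ n * (∏ i, ((ν i : ℝ) ^ (ν i) / ((ν i).factorial : ℝ))) *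
      Real.exp (n * (-∑ i, ((ν i : ℝ) / n) * Real.log ((ν i : ℝ) / n))) := by
  have hn0 : (0 : ℝ) < n := by positivity
  rw [ec_nH m n hn ν hν]
  have h := Nat.multinomial_spec Finset.univ ν
  rw [hν] at h
  have h' : (∏ i, ((ν i).factorial : ℝ)) * (Nat.multinomial Finset.univ ν : ℝ) = n.factorial := by
    exact_mod_cast h
  have hpow : ∀ k : ℕ, (k : ℝ) ^ k = Real.exp (k * Real.log k) := by
    intro k
    rcases Nat.eq_zero_or_pos k with h | h
    · simp [h]
    have : (0 : ℝ) < k := by positivity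
    rw [Real.exp_nat_mul, Real.exp_log this]
  have hP : ∏ i, (ν i : ℝ) ^ (ν i) = Real.exp (∑ i, (ν i : ℝ) * Real.log (ν i)) := by
    rw [Real.exp_sum]
    exact Finset.prod_congr rfl fun i _ => hpow _
  have hF : (∏ i, ((ν i).factorial : ℝ)) ≠ 0 := Finset.prod_ne_zero_iff.2 fun i _ => by positivity
  rw [Finset.prod_div_distrib, hP, Real.exp_sub, ← hpow n, ← h']
  have := Real.exp_pos (∑ i, (ν i : ℝ) * Real.log (ν i))
  field_simp

lemma ec_B_bound (m n : ℕ) (hn : 1 ≤ n) (P : (Fin m → ℕ) → Prop) [DecidablePred P] (h : ℝ)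
    (hP : ∀ ν, P ν → -∑ i, ((ν i : ℝ) / n) * Real.log ((ν i : ℝ) / n) ≤ h) :
    ∑ ν ∈ (Finset.Nat.antidiagonalTuple m n).filter P, (Nat.multinomial Finset.univ ν : ℝ) ≤
      ecD n m * Real.exp (n * h) := by
  have hn0 : (0 : ℝ) < n := by positivity
  rw [ecD, ec_coeff_pow, Finset.mul_sum, Finset.sum_mul]
  calc _ ≤ ∑ ν ∈ (Finset.Nat.antidiagonalTuple m n).filter P,
        (n.factorial : ℝ) / (n : ℝ) ^ n * (∏ i, ((ν i : ℝ) ^ (ν i) / ((ν i).factorial : ℝ))) *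
      Real.exp (n * h) := by
        refine Finset.sum_le_sum fun ν hν => ?_
        rw [Finset.mem_filter] at hν
        rw [ec_multi_eq m n hn ν (Finset.Nat.mem_antidiagonalTuple.1 hν.1)]
        have := hP ν hν.2
        gcongr
    _ ≤ _ := Finset.sum_le_sum_of_subset_of_nonneg (Finset.filter_subset _ _) fun ν _ _ => by positivity

lemma ec_bAbs_pos {k : ℕ} (b : Fin (k + 1) → ℝ) (hb : ∀ i, b i ≠ 0) : 0 < bAbsMin b := by
  obtain ⟨i, hi⟩ := exists_eq_ciInf_of_finite (f := fun i => |b i|)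
  rw [bAbsMin, ← hi]
  exact abs_pos.2 (hb i)

lemma ec_row_le {k m : ℕ} (A : Matrix (Fin (k + 1)) (Fin m) ℝ) (i : Fin (k + 1)) :
    ∑ j, |A i j| ≤ rowNorm A :=
  le_ciSup (f := fun i => ∑ j, |A i j|) (Set.finite_range _).bddAbove i

lemma ec_row_pos {k m : ℕ} (A : Matrix (Fin (k + 1)) (Fin m) ℝ) (hA : A ≠ 0) : 0 < rowNorm A := by
  obtain ⟨i, j, hij⟩ : ∃ i j, A i j ≠ 0 := by
    by_contra h
    push Not at h
    exact hA (by ext i j; simpa using h i j)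
  refine lt_of_lt_of_le ?_ (ec_row_le A i)
  exact lt_of_lt_of_le (abs_pos.2 hij)
    (Finset.single_le_sum (f := fun j => |A i j|) (fun j _ => abs_nonneg _) (mem_univ j))

lemma ec_mulVec {k m : ℕ} (A : Matrix (Fin (k + 1)) (Fin m) ℝ) (hA : A ≠ 0) (φ f : Fin m → ℝ)
    (θ t : ℝ) (hf : ∀ j, |f j - φ j| ≤ θ) (ht : θ ≤ t / rowNorm A) (i : Fin (k + 1)) :
    |A.mulVec f i - A.mulVec φ i| ≤ t := by
  have hp := ec_row_pos A hA
  have hm : 0 ≤ θ ∨ m = 0 := by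
    rcases Nat.eq_zero_or_pos m with h | h
    · right; exact h
    · left; exact (abs_nonneg _).trans (hf ⟨0, h⟩)
  have hm' : 0 ≤ θ := by
    rcases hm with h | h
    · exact h
    · subst h; exact absurd (by ext i j; exact j.elim0) hA
  have : A.mulVec f i - A.mulVec φ i = ∑ j, A i j * (f j - φ j) := by
    simp only [Matrix.mulVec, dotProduct, ← Finset.sum_sub_distrib]
    exact Finset.sum_congr rfl fun j _ => by ring
  rw [this]
  calc _ ≤ ∑ j, |A i j * (f j - φ j)| := Finset.abs_sum_le_sum_abs _ _
    _ ≤ ∑ j, |A i j| * θ := Finset.sum_le_sum fun j _ => by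
        rw [abs_mul]; exact mul_le_mul_of_nonneg_left (hf j) (abs_nonneg _)
    _ = (∑ j, |A i j|) * θ := by rw [Finset.sum_mul]
    _ ≤ rowNorm A * θ := mul_le_mul_of_nonneg_right (ec_row_le A i) hm'
    _ ≤ t := by rw [mul_comm]; exact (le_div_iff₀ hp).1 ht

set_option maxHeartbeats 2000000 in
/-- Entropy concentration (Theorem 1 of the paper, with `μ* = m`): for
`n ≥ 100`, `n ≥ C₁ ln n + C₂` and `n ≥ (m−1)/(2θ₀)`, the realizations of frequency
vectors in `F_n ∩ C(δ)` with entropy at least `(1−η)H*` are a fraction at least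
`1 − ε` of all realizations of vectors in `F_n ∩ C(δ)`. -/
theorem stmt_10 {m ke kle ke0 kle0 : ℕ} (hm : 2 ≤ m)
    (Aeq : Matrix (Fin (ke + 1)) (Fin m) ℝ) (beq : Fin (ke + 1) → ℝ)
    (Ale : Matrix (Fin (kle + 1)) (Fin m) ℝ) (ble : Fin (kle + 1) → ℝ)
    (Aeq0 : Matrix (Fin (ke0 + 1)) (Fin m) ℝ)
    (Ale0 : Matrix (Fin (kle0 + 1)) (Fin m) ℝ)
    (hAeq : Aeq ≠ 0) (hAle : Ale ≠ 0) (hAeq0 : Aeq0 ≠ 0) (hAle0 : Ale0 ≠ 0)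
    (hbeq : ∀ i, beq i ≠ 0) (hble : ∀ i, ble i ≠ 0)
    (deq dle deq0 dle0 : ℝ)
    (hdeq : 0 < deq) (hdle : 0 < dle) (hdeq0 : 0 < deq0) (hdle0 : 0 < dle0)
    (φ : Fin m → ℝ) (hφpos : ∀ i, 0 < φ i) (hφ1 : ∑ i, φ i = 1)
    (hsat : ExactSat Aeq beq Ale ble Aeq0 Ale0 φ)
    (hopt : ∀ x : Fin m → ℝ, (∀ i, 0 ≤ x i) → ∑ i, x i = 1 →
      ExactSat Aeq beq Ale ble Aeq0 Ale0 x →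
      -∑ i, x i * Real.log (x i) ≤ -∑ i, φ i * Real.log (φ i))
    (Hs : ℝ) (hHs : Hs = -∑ i, φ i * Real.log (φ i)) (hHpos : 0 < Hs)
    (φmin : ℝ) (hφmin : (∃ i, φ i = φmin) ∧ ∀ i, φmin ≤ φ i)
    (ε : ℝ) (hε : 0 < ε)
    (η α : ℝ) (hη : 0 < η) (hα : α ∈ Set.Ioo (0 : ℝ) 1)
    (h21 : 21 ≤ (m : ℝ) / (α * η * Hs))
    (θ₀ : ℝ)
    (hθ₀ : θ₀ = min (thetaInf Aeq beq Ale ble Aeq0 Ale0 deq dle deq0 dle0)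
        ((2 / 3) * α * η * Hs / Real.log ((m : ℝ) / (α * η * Hs))))
    (hθ₀lt : θ₀ < φmin)
    (C₁ C₂ : ℝ)
    (hC₁ : C₁ = ((m : ℝ) - 1) / ((1 - α) * η * Hs))
    (hC₂ : C₂ = ((m : ℝ) * Real.log 0.6 +
        (0.5 * Real.log (2 * Real.pi) + 1 / 12 - 0.5 * Real.log (m : ℝ)) * (m : ℝ) +
        Real.log ((1 / ε + 1) / 0.249)) / ((1 - α) * η * Hs))
    (n : ℕ) (hn100 : 100 ≤ n)
    (hnlog : C₁ * Real.log (n : ℝ) + C₂ ≤ (n : ℝ))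
    (hnθ₀ : ((m : ℝ) - 1) / (2 * θ₀) ≤ (n : ℝ)) :
    1 - ε ≤
      (∑ ν ∈ (Finset.Nat.antidiagonalTuple m n).filter
          (fun ν => InC Aeq beq Ale ble Aeq0 Ale0 deq dle deq0 dle0
              (fun i => (ν i : ℝ) / n) ∧
            (1 - η) * Hs ≤ -∑ i, ((ν i : ℝ) / n) * Real.log ((ν i : ℝ) / n)),
          (Nat.multinomial Finset.univ ν : ℝ)) /
      ((∑ ν ∈ (Finset.Nat.antidiagonalTuple m n).filter
          (fun ν => InC Aeq beq Ale ble Aeq0 Ale0 deq dle deq0 dle0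
              (fun i => (ν i : ℝ) / n) ∧
            (1 - η) * Hs ≤ -∑ i, ((ν i : ℝ) / n) * Real.log ((ν i : ℝ) / n)),
          (Nat.multinomial Finset.univ ν : ℝ)) +
       (∑ ν ∈ (Finset.Nat.antidiagonalTuple m n).filter
          (fun ν => InC Aeq beq Ale ble Aeq0 Ale0 deq dle deq0 dle0
              (fun i => (ν i : ℝ) / n) ∧
            -∑ i, ((ν i : ℝ) / n) * Real.log ((ν i : ℝ) / n) < (1 - η) * Hs),
          (Nat.multinomial Finset.univ ν : ℝ))) := by
  have hm2 : (2 : ℝ) ≤ m := by exact_mod_cast hm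
  have hm0 : (0 : ℝ) < m := by linarith
  have hn0 : (0 : ℝ) < n := by positivity
  obtain ⟨hα0, hα1⟩ := hα
  set a := α * η * Hs with ha
  have ha0 : 0 < a := by positivity
  set L := Real.log ((m : ℝ) / a) with hL
  have hL0 : 0 < L := Real.log_pos (by linarith)
  -- positivity of the tolerance
  have hb1 := ec_bAbs_pos beq hbeq
  have hb2 := ec_bAbs_pos ble hble
  have hr1 := ec_row_pos Aeq hAeq
  have hr2 := ec_row_pos Ale hAle
  have hr3 := ec_row_pos Aeq0 hAeq0
  have hr4 := ec_row_pos Ale0 hAle0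
  have hθpos : 0 < θ₀ := by
    rw [hθ₀]
    refine lt_min (lt_min (lt_min ?_ ?_) (lt_min ?_ ?_)) ?_ <;> positivity
  have hθT : θ₀ ≤ thetaInf Aeq beq Ale ble Aeq0 Ale0 deq dle deq0 dle0 := by
    rw [hθ₀]; exact min_le_left _ _
  have hθL : θ₀ ≤ (2 / 3) * a / L := by
    rw [hθ₀]; refine (min_le_right _ _).trans (le_of_eq ?_)
    rw [ha]; ring
  have hT1 : θ₀ ≤ deq * bAbsMin beq / rowNorm Aeq :=
    hθT.trans ((min_le_left _ _).trans (min_le_left _ _))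
  have hT2 : θ₀ ≤ dle * bAbsMin ble / rowNorm Ale :=
    hθT.trans ((min_le_left _ _).trans (min_le_right _ _))
  have hT3 : θ₀ ≤ deq0 / rowNorm Aeq0 :=
    hθT.trans ((min_le_right _ _).trans (min_le_left _ _))
  have hT4 : θ₀ ≤ dle0 / rowNorm Ale0 :=
    hθT.trans ((min_le_right _ _).trans (min_le_right _ _))
  have hnθ : ((m : ℝ) - 1) / 2 ≤ n * θ₀ := by
    rw [div_le_iff₀ (by positivity)] at hnθ₀
    linarith
  -- the rounding
  obtain ⟨ν, hνs, hνpos, hνabs⟩ := ec_round m n hm (fun i => n * φ i)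
    (by rw [← Finset.mul_sum, hφ1, mul_one])
    (fun i => lt_of_le_of_lt hnθ (mul_lt_mul_of_pos_left (lt_of_lt_of_le hθ₀lt (hφmin.2 i)) hn0))
  set f : Fin m → ℝ := fun i => (ν i : ℝ) / n with hf
  have hν1 : ∀ i, (1 : ℝ) ≤ ν i := fun i => by exact_mod_cast hνpos i
  have hfpos : ∀ i, 0 < f i := fun i => div_pos (by linarith [hν1 i]) hn0
  have hf1 : ∑ i, f i = 1 := by
    rw [hf, ← Finset.sum_div, div_eq_one_iff_eq hn0.ne']
    exact_mod_cast hνs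
  have hdiff : ∀ i, n * |φ i - f i| ≤ ((m : ℝ) - 1) / m := by
    intro i
    have h := hνabs i
    have e : (n : ℝ) * |φ i - f i| = |(n : ℝ) * φ i - ν i| := by
      rw [← abs_of_pos hn0, ← abs_mul, abs_of_pos hn0]
      congr 1
      simp only [hf]
      field_simp
    rw [e]; exact h
  have hmm : ((m : ℝ) - 1) / m ≤ ((m : ℝ) - 1) / 2 :=
    div_le_div_of_nonneg_left (by linarith) (by norm_num) hm2
  have hsup : ∀ i, |f i - φ i| ≤ θ₀ := by
    intro i
    rw [abs_sub_comm]
    exact le_of_mul_le_mul_left ((hdiff i).trans (hmm.trans hnθ)) hn0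
  have hdf : ∀ i, φ i - f i ≤ f i := by
    intro i
    refine (le_abs_self _).trans ?_
    have h1 : ((m : ℝ) - 1) / m ≤ 1 := by rw [div_le_one hm0]; linarith
    have h2 : n * f i = ν i := by simp only [hf]; field_simp
    have h3 := hν1 i
    exact le_of_mul_le_mul_left (by linarith [hdiff i]) hn0
  have hd : ∑ i, |φ i - f i| ≤ 2 * ((2 / 3) * a / L) := by
    have h1 : n * ∑ i, |φ i - f i| ≤ n * (2 * θ₀) := by
      rw [Finset.mul_sum]
      calc _ ≤ ∑ _i : Fin m, ((m : ℝ) - 1) / m := Finset.sum_le_sum fun i _ => hdiff i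
        _ = (m : ℝ) - 1 := by simp; field_simp
        _ ≤ _ := by linarith
    have := le_of_mul_le_mul_left h1 hn0
    linarith
  have hent := ec_entropy m hm φ f hφpos hφ1 hfpos hf1 hdf a ha0 h21 hd
  rw [← hHs] at hent
  -- f lies in A
  have hInC : InC Aeq beq Ale ble Aeq0 Ale0 deq dle deq0 dle0 f := by
    obtain ⟨s1, s2, s3, s4⟩ := hsat
    refine ⟨fun i => ?_, fun i => ?_, fun i => ?_, fun i => ?_⟩
    · have := ec_mulVec Aeq hAeq φ f θ₀ _ hsup hT1 i
      rwa [s1] at this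
    · have := (abs_le.1 (ec_mulVec Ale hAle φ f θ₀ _ hsup hT2 i)).2
      linarith [s2 i]
    · have := ec_mulVec Aeq0 hAeq0 φ f θ₀ _ hsup hT3 i
      rwa [s3, Pi.zero_apply, sub_zero] at this
    · have := (abs_le.1 (ec_mulVec Ale0 hAle0 φ f θ₀ _ hsup hT4 i)).2
      linarith [s4 i]
  have hge : (1 - η) * Hs ≤ -∑ i, f i * Real.log (f i) := by
    have : a ≤ η * Hs := by
      rw [ha, mul_assoc]; nlinarith [mul_pos hη hHpos]
    linarith
  have hB := ec_B_bound m n (by omega) (fun ν => InC Aeq beq Ale ble Aeq0 Ale0 deq dle deq0 dle0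
              (fun i => (ν i : ℝ) / n) ∧
            -∑ i, ((ν i : ℝ) / n) * Real.log ((ν i : ℝ) / n) < (1 - η) * Hs) ((1 - η) * Hs)
            (fun ν h => h.2.le)
  have hA : (Nat.multinomial Finset.univ ν : ℝ) ≤ ∑ ν ∈ (Finset.Nat.antidiagonalTuple m n).filter
          (fun ν => InC Aeq beq Ale ble Aeq0 Ale0 deq dle deq0 dle0
              (fun i => (ν i : ℝ) / n) ∧
            (1 - η) * Hs ≤ -∑ i, ((ν i : ℝ) / n) * Real.log ((ν i : ℝ) / n)),
          (Nat.multinomial Finset.univ ν : ℝ) := by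
    refine Finset.single_le_sum (f := fun ν => (Nat.multinomial Finset.univ ν : ℝ))
      (fun _ _ => Nat.cast_nonneg _) ?_
    rw [Finset.mem_filter]
    exact ⟨Finset.Nat.mem_antidiagonalTuple.2 hνs, hInC, hge⟩
  have hB0 : 0 ≤ ∑ ν ∈ (Finset.Nat.antidiagonalTuple m n).filter
          (fun ν => InC Aeq beq Ale ble Aeq0 Ale0 deq dle deq0 dle0
              (fun i => (ν i : ℝ) / n) ∧
            -∑ i, ((ν i : ℝ) / n) * Real.log ((ν i : ℝ) / n) < (1 - η) * Hs),
          (Nat.multinomial Finset.univ ν : ℝ) := Finset.sum_nonneg fun _ _ => Nat.cast_nonneg _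
  have hM0 : (0 : ℝ) < Nat.multinomial Finset.univ ν := by
    have := Nat.multinomial_pos Finset.univ ν; positivity
  generalize (∑ ν ∈ (Finset.Nat.antidiagonalTuple m n).filter
          (fun ν => InC Aeq beq Ale ble Aeq0 Ale0 deq dle deq0 dle0
              (fun i => (ν i : ℝ) / n) ∧
            -∑ i, ((ν i : ℝ) / n) * Real.log ((ν i : ℝ) / n) < (1 - η) * Hs),
          (Nat.multinomial Finset.univ ν : ℝ)) = SB at hB hB0 ⊢
  generalize (∑ ν ∈ (Finset.Nat.antidiagonalTuple m n).filter
          (fun ν => InC Aeq beq Ale ble Aeq0 Ale0 deq dle deq0 dle0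
              (fun i => (ν i : ℝ) / n) ∧
            (1 - η) * Hs ≤ -∑ i, ((ν i : ℝ) / n) * Real.log ((ν i : ℝ) / n)),
          (Nat.multinomial Finset.univ ν : ℝ)) = SA at hA ⊢
  have hSA : 0 < SA := lt_of_lt_of_le hM0 hA
  -- logarithmic comparison
  have hpi := Real.pi_gt_d2
  have hs0 : 0 < Real.sqrt n := Real.sqrt_pos.2 hn0
  have hDle : ecD n m ≤ 10.06 * (0.6 * Real.sqrt n) ^ m / Real.sqrt n := by
    rw [le_div_iff₀ hs0]; exact ecD_bound n hn100 m (by omega)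
  have hK : Real.log 10.06 ≤ 0.5 * Real.log (2 * Real.pi) - Real.log 0.249 := by
    have h1 : 0.5 * Real.log (2 * Real.pi) = Real.log (Real.sqrt (2 * Real.pi)) := by
      rw [Real.log_sqrt (by positivity)]; ring
    rw [h1, ← Real.log_div (by positivity) (by norm_num)]
    apply Real.log_le_log (by norm_num)
    rw [le_div_iff₀ (by norm_num)]
    apply Real.le_sqrt_of_sq_le
    norm_num at hpi ⊢
    linarith
  have hU : Real.log (10.06 * (0.6 * Real.sqrt n) ^ m / Real.sqrt n) =
      Real.log 10.06 + m * (Real.log 0.6 + Real.log n / 2) - Real.log n / 2 := by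
    rw [Real.log_div (by positivity) (by positivity), Real.log_mul (by norm_num) (by positivity),
      Real.log_pow, Real.log_mul (by norm_num) (by positivity), Real.log_sqrt hn0.le]
  have hlow := ec_multi_lower m n (by omega) (by omega) ν hνs hνpos
  have hc0 : 0 < (1 - α) * η * Hs := by
    have : 0 < 1 - α := by linarith
    positivity
  have hcond : ((m : ℝ) - 1) * Real.log n + ((m : ℝ) * Real.log 0.6 +
        (0.5 * Real.log (2 * Real.pi) + 1 / 12 - 0.5 * Real.log (m : ℝ)) * (m : ℝ) +
        Real.log ((1 / ε + 1) / 0.249)) ≤ n * ((1 - α) * η * Hs) := by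
    rw [hC₁, hC₂, div_mul_eq_mul_div, ← add_div, div_le_iff₀ hc0] at hnlog
    exact hnlog
  rw [Real.log_div (by positivity) (by norm_num)] at hcond
  have hnent : n * (Hs - a) ≤ n * (-∑ i, f i * Real.log (f i)) :=
    mul_le_mul_of_nonneg_left hent hn0.le
  have hfin : Real.log (10.06 * (0.6 * Real.sqrt n) ^ m / Real.sqrt n) + n * ((1 - η) * Hs)
      + Real.log (1 / ε + 1) ≤ Real.log (Nat.multinomial Finset.univ ν : ℝ) := by
    rw [hU]
    have e : n * (Hs - a) = n * ((1 - η) * Hs) + n * ((1 - α) * η * Hs) := by rw [ha]; ring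
    simp only [hf] at hnent
    linarith
  have hexp : 10.06 * (0.6 * Real.sqrt n) ^ m / Real.sqrt n * Real.exp (n * ((1 - η) * Hs)) *
      (1 / ε + 1) ≤ (Nat.multinomial Finset.univ ν : ℝ) := by
    rw [← Real.log_le_log_iff (by positivity) hM0, Real.log_mul (by positivity) (by positivity),
      Real.log_mul (by positivity) (by positivity), Real.log_exp]
    exact hfin
  have hBA : SB * (1 / ε + 1) ≤ SA := by
    refine le_trans ?_ (hexp.trans hA)
    refine mul_le_mul_of_nonneg_right (hB.trans ?_) (by positivity)
    exact mul_le_mul_of_nonneg_right hDle (Real.exp_pos _).le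
  rw [le_div_iff₀ (by linarith)]
  have h1 : SB * (1 / ε) ≤ SA := by linarith
  have h2 : SB ≤ ε * SA := by
    rw [mul_one_div, div_le_iff₀ hε] at h1; linarith
  nlinarith [mul_nonneg hε.le hB0]
end

section
/- Let C ⊆ ℝ^m be a convex set of probability vectors, let φ* ∈ C maximize H over C, and set H* = H(φ*). Let 0 < θ ≤ 1/2. Then: (i) every probability vector f with ‖f − φ*‖₁ ≤ θ satisfies H(f) ≥ H* − θ·ln(m/θ); (ii) every f ∈ C with ‖f − φ*‖₁ > θ satisfies H(f) < H* − θ²/2. -/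
open BigOperators Finset

theorem aux_log4 : (1:ℝ) ≤ Real.log 4 := by
  have h : (4:ℝ) = 2 ^ 2 := by norm_num
  rw [h, Real.log_pow]
  have := Real.log_two_gt_d9
  push_cast
  linarith

theorem aux_hasDeriv (x : ℝ) (hx : 0 < x) :
    HasDerivAt (fun x : ℝ => Real.log x - (5 * x ^ 2 - 4 * x - 1) / (2 * x ^ 2 + 4 * x))
      ((x - 1) ^ 3 / (x ^ 2 * (x + 2) ^ 2)) x := by
  have h1 := Real.hasDerivAt_log hx.ne'
  have hid := hasDerivAt_id x
  have h2 : HasDerivAt (fun x : ℝ => 5 * x ^ 2 - 4 * x - 1) (10 * x - 4) x := by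
    have := (((hid.pow 2).const_mul 5).sub (hid.const_mul 4)).sub_const 1
    exact this.congr_deriv (by simp; ring)
  have h3 : HasDerivAt (fun x : ℝ => 2 * x ^ 2 + 4 * x) (4 * x + 4) x := by
    have := (((hid.pow 2).const_mul 2).add (hid.const_mul 4))
    exact this.congr_deriv (by simp; ring)
  have hne : 2 * x ^ 2 + 4 * x ≠ 0 := by positivity
  refine (h1.sub (h2.div h3 hne)).congr_deriv ?_
  have : 2 * x ^ 2 + 4 * x = 2 * (x * (x + 2)) := by ring
  rw [this]
  field_simp
  ring

theorem aux_log (x : ℝ) (hx : 0 < x) :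
    (5 * x ^ 2 - 4 * x - 1) / (2 * x ^ 2 + 4 * x) ≤ Real.log x := by
  set h : ℝ → ℝ := fun x : ℝ => Real.log x - (5 * x ^ 2 - 4 * x - 1) / (2 * x ^ 2 + 4 * x) with hh
  have h1 : h 1 = 0 := by simp [hh]; norm_num
  suffices 0 ≤ h x by simp only [hh] at this; linarith
  rw [← h1]
  rcases le_total 1 x with hx1 | hx1
  · have : MonotoneOn h (Set.Ici 1) := by
      apply monotoneOn_of_deriv_nonneg (convex_Ici 1)
      · intro y hy
        have hy : (1:ℝ) ≤ y := hy
        exact (aux_hasDeriv y (by linarith)).continuousAt.continuousWithinAt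
      · intro y hy
        rw [interior_Ici] at hy
        have hy : (1:ℝ) < y := hy
        exact (aux_hasDeriv y (by linarith)).differentiableAt.differentiableWithinAt
      · intro y hy
        rw [interior_Ici] at hy
        have hy : (1:ℝ) < y := hy
        rw [(aux_hasDeriv y (by linarith)).deriv]
        have : 0 < y - 1 := by linarith
        positivity
    exact this (by simp) hx1 hx1
  · have : AntitoneOn h (Set.Ioc 0 1) := by
      apply antitoneOn_of_deriv_nonpos (convex_Ioc 0 1)
      · intro y hy
        exact (aux_hasDeriv y hy.1).continuousAt.continuousWithinAt
      · intro y hy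
        rw [interior_Ioc] at hy
        exact (aux_hasDeriv y hy.1).differentiableAt.differentiableWithinAt
      · intro y hy
        rw [interior_Ioc] at hy
        rw [(aux_hasDeriv y hy.1).deriv]
        apply div_nonpos_of_nonpos_of_nonneg
        · have : y - 1 ≤ 0 := by linarith [hy.2]
          exact Odd.pow_nonpos (by decide) this
        · positivity
    exact this ⟨hx, hx1⟩ (by simp) hx1

/-- Pointwise form of Pinsker. -/
theorem aux_point (p r : ℝ) (hp : 0 ≤ p) (hr : 0 < r) :
    3 / 2 * ((p - r) ^ 2 / (p + 2 * r)) ≤ p * Real.log p - p * Real.log r - p + r := by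
  rcases hp.eq_or_lt with rfl | hp
  · have : (0 - r) ^ 2 / (0 + 2 * r) = r / 2 := by field_simp; ring
    rw [this]
    simp
    linarith
  · have h := mul_le_mul_of_nonneg_left (aux_log (p / r) (by positivity)) hp.le
    rw [Real.log_div hp.ne' hr.ne'] at h
    have e : p * ((5 * (p / r) ^ 2 - 4 * (p / r) - 1) / (2 * (p / r) ^ 2 + 4 * (p / r)))
        = 3 / 2 * ((p - r) ^ 2 / (p + 2 * r)) + p - r := by
      have : 2 * (p / r) ^ 2 + 4 * (p / r) = 2 * p * (p + 2 * r) / r ^ 2 := by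
        field_simp; ring
      rw [this]
      field_simp
      ring
    rw [e] at h
    linarith

theorem aux_pinsker {m : ℕ} (p r : Fin m → ℝ) (hp : ∀ i, 0 ≤ p i) (hr : ∀ i, 0 ≤ r i)
    (hpr : ∀ i, r i = 0 → p i = 0) (sp : ∑ i, p i = 1) (sr : ∑ i, r i = 1) :
    (∑ i, |p i - r i|) ^ 2 / 2 ≤ ∑ i, p i * Real.log (p i) - ∑ i, p i * Real.log (r i) := by
  have hpt : ∀ i, 3 / 2 * ((p i - r i) ^ 2 / (p i + 2 * r i)) ≤
      p i * Real.log (p i) - p i * Real.log (r i) - p i + r i := by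
    intro i
    rcases (hr i).eq_or_lt with h | h
    · simp [hpr i h.symm, ← h]
    · exact aux_point _ _ (hp i) h
  have hs := Finset.sum_le_sum (s := Finset.univ) (fun i _ => hpt i)
  rw [← Finset.mul_sum, Finset.sum_add_distrib, Finset.sum_sub_distrib,
    Finset.sum_sub_distrib, sp, sr] at hs
  have hcs : (∑ i, |p i - r i|) ^ 2 ≤
      (∑ i, (p i - r i) ^ 2 / (p i + 2 * r i)) * ∑ i, (p i + 2 * r i) := by
    apply Finset.sum_sq_le_sum_mul_sum_of_sq_eq_mul
    · intro i _
      have := hp i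
      have := hr i
      positivity
    · intro i _
      have := hp i
      have := hr i
      positivity
    · intro i _
      rw [sq_abs]
      rcases (hr i).eq_or_lt with h | h
      · simp [hpr i h.symm, ← h]
      · have := hp i
        field_simp
  rw [Finset.sum_add_distrib, ← Finset.mul_sum, sp, sr] at hcs
  linarith

theorem aux_point1 (a b : ℝ) (ha : 0 ≤ a) (hb : 0 ≤ b) (hb1 : b ≤ 1) (hd : |b - a| ≤ 1 / 4) :
    b * Real.log b - a * Real.log a ≤ -(|b - a| * Real.log |b - a|) := by
  rcases le_total a b with h | h
  · rw [abs_of_nonneg (by linarith)] at hd ⊢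
    obtain ⟨d, rfl⟩ : ∃ d, b = a + d := ⟨b - a, by ring⟩
    simp only [add_sub_cancel_left] at *
    have hd0 : 0 ≤ d := by linarith
    rcases hd0.eq_or_lt with rfl | hd0
    · simp
    have h4 : Real.log d ≤ -1 := by
      have h1 := Real.log_le_log hd0 hd
      rw [one_div, Real.log_inv] at h1
      linarith [aux_log4]
    have h5 : Real.log (a + d) ≤ 0 := Real.log_nonpos hb hb1
    have h6 : a * Real.log (a + d) - a * Real.log a ≤ d := by
      rcases ha.eq_or_lt with rfl | ha
      · simp [hd0.le]
      have := Real.log_le_sub_one_of_pos (show 0 < (a + d) / a by positivity)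
      rw [Real.log_div (by positivity) (by positivity)] at this
      have := mul_le_mul_of_nonneg_left this ha.le
      have e : a * ((a + d) / a - 1) = d := by field_simp; ring
      linarith
    nlinarith
  · rw [abs_of_nonpos (by linarith)]
    obtain ⟨d, rfl⟩ : ∃ d, a = b + d := ⟨a - b, by ring⟩
    have e : -(b - (b + d)) = d := by ring
    rw [e]
    have hd0 : 0 ≤ d := by linarith
    have k1 : b * Real.log b ≤ b * Real.log (b + d) := by
      rcases hb.eq_or_lt with rfl | hb
      · simp
      exact mul_le_mul_of_nonneg_left (Real.log_le_log hb h) hb.le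
    have k2 : d * Real.log d ≤ d * Real.log (b + d) := by
      rcases hd0.eq_or_lt with rfl | hd0
      · simp
      exact mul_le_mul_of_nonneg_left (Real.log_le_log hd0 (by linarith)) hd0.le
    linarith

theorem aux_point2 (x c : ℝ) (hx : 0 ≤ x) (hc : 0 < c) :
    -(x * Real.log x) ≤ -(x * Real.log c) + c - x := by
  rcases hx.eq_or_lt with rfl | hx
  · simp [hc.le]
  have := Real.log_le_sub_one_of_pos (show 0 < c / x by positivity)
  rw [Real.log_div (by positivity) (by positivity)] at this
  have := mul_le_mul_of_nonneg_left this hx.le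
  have e : x * (c / x - 1) = c - x := by field_simp
  linarith

/-- Let `C` be a convex set of probability vectors in `ℝ^m`, `φ*` a
maximizer of entropy over `C` with `H* = H(φ*)`, and `0 < θ ≤ 1/2`. Then (i) every
probability vector within ℓ1 distance `θ` of `φ*` has entropy `≥ H* − θ·ln(m/θ)`, and
(ii) every member of `C` at ℓ1 distance more than `θ` from `φ*` has entropy
`< H* − θ²/2`. -/
theorem stmt_12 (m : ℕ) (hm : 2 ≤ m) (C : Set (Fin m → ℝ))
    (hCprob : ∀ x ∈ C, (∀ i, 0 ≤ x i) ∧ ∑ i, x i = 1)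
    (hCconv : Convex ℝ C)
    (φ : Fin m → ℝ) (hφC : φ ∈ C)
    (hφmax : ∀ x ∈ C, -∑ i, x i * Real.log (x i) ≤ -∑ i, φ i * Real.log (φ i))
    (Hs : ℝ) (hHs : Hs = -∑ i, φ i * Real.log (φ i))
    (θ : ℝ) (hθ0 : 0 < θ) (hθ : θ ≤ 1 / 2) :
    (∀ f : Fin m → ℝ, (∀ i, 0 ≤ f i) → ∑ i, f i = 1 →
      (∑ i, |f i - φ i|) ≤ θ →
      Hs - θ * Real.log ((m : ℝ) / θ) ≤ -∑ i, f i * Real.log (f i)) ∧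
    (∀ f ∈ C, (∑ i, |f i - φ i|) > θ →
      -∑ i, f i * Real.log (f i) < Hs - θ ^ 2 / 2) := by
  subst hHs
  obtain ⟨hφ0, hφ1⟩ := hCprob φ hφC
  have hm0 : (0:ℝ) < m := by positivity
  constructor
  · intro f hf0 hf1 hd
    have hle1 : ∀ i, f i ≤ 1 := fun i => by
      rw [← hf1]
      exact Finset.single_le_sum (fun j _ => hf0 j) (Finset.mem_univ i)
    have hq : ∀ i, |f i - φ i| ≤ 1 / 4 := by
      intro i
      have e1 : ∑ j, (f j - φ j) = 0 := by rw [Finset.sum_sub_distrib, hf1, hφ1]; ring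
      rw [← Finset.add_sum_erase _ _ (Finset.mem_univ i)] at e1 hd
      have e2 := Finset.abs_sum_le_sum_abs (fun j => f j - φ j) (Finset.univ.erase i)
      have e3 : ∑ j ∈ Finset.univ.erase i, (f j - φ j) = -(f i - φ i) := by linarith
      rw [e3, abs_neg] at e2
      linarith
    have hc : 0 < θ / m := by positivity
    have hs : ∑ i, (f i * Real.log (f i) - φ i * Real.log (φ i)) ≤
        ∑ i, (|f i - φ i| * Real.log (m / θ) + θ / m - |f i - φ i|) := by
      apply Finset.sum_le_sum
      intro i _
      have h1 := aux_point1 (φ i) (f i) (hφ0 i) (hf0 i) (hle1 i) (hq i)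
      have h2 := aux_point2 |f i - φ i| (θ / m) (abs_nonneg _) hc
      have h3 : Real.log (m / θ) = - Real.log (θ / m) := by
        rw [← Real.log_inv, inv_div]
      rw [h3]
      linarith
    rw [Finset.sum_sub_distrib, Finset.sum_sub_distrib, Finset.sum_add_distrib,
      ← Finset.sum_mul] at hs
    have e4 : ∑ _i : Fin m, θ / (m:ℝ) = θ := by
      simp
      field_simp
    rw [e4] at hs
    have h5 : 1 ≤ Real.log (m / θ) := by
      refine aux_log4.trans (Real.log_le_log (by norm_num) ?_)
      rw [le_div_iff₀ hθ0]
      have : (2:ℝ) ≤ m := by exact_mod_cast hm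
      linarith
    nlinarith
  · intro f hfC hd
    obtain ⟨hf0, hf1⟩ := hCprob f hfC
    set d := ∑ i, |f i - φ i| with hdd
    have key : ∀ t : ℝ, 0 < t → t < 1 →
        -∑ i, f i * Real.log (f i) + (1 - t) * d ^ 2 / 2 ≤ -∑ i, φ i * Real.log (φ i) := by
      intro t ht0 ht1
      set r : Fin m → ℝ := (1 - t) • φ + t • f with hr
      have hri : ∀ i, r i = (1 - t) * φ i + t * f i := fun i => by simp [hr]
      have hrC : r ∈ C := hCconv hφC hfC (by linarith) ht0.le (by ring)
      obtain ⟨hr0, hr1⟩ := hCprob r hrC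
      have hmax := hφmax r hrC
      have ht1' : 0 < 1 - t := by linarith
      have p1 := aux_pinsker φ r hφ0 hr0 (fun i h => by
        rw [hri] at h
        have a1 := mul_nonneg ht0.le (hf0 i)
        have a2 := mul_nonneg ht1'.le (hφ0 i)
        have : (1 - t) * φ i = 0 := by linarith
        exact (mul_eq_zero.mp this).resolve_left ht1'.ne') hφ1 hr1
      have p2 := aux_pinsker f r hf0 hr0 (fun i h => by
        rw [hri] at h
        have a1 := mul_nonneg ht0.le (hf0 i)
        have a2 := mul_nonneg ht1'.le (hφ0 i)
        have : t * f i = 0 := by linarith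
        exact (mul_eq_zero.mp this).resolve_left ht0.ne') hf1 hr1
      have d1 : ∑ i, |φ i - r i| = t * d := by
        rw [hdd, Finset.mul_sum]
        refine Finset.sum_congr rfl fun i _ => ?_
        rw [hri, show φ i - ((1 - t) * φ i + t * f i) = -(t * (f i - φ i)) by ring, abs_neg,
          abs_mul, abs_of_pos ht0]
      have d2 : ∑ i, |f i - r i| = (1 - t) * d := by
        rw [hdd, Finset.mul_sum]
        refine Finset.sum_congr rfl fun i _ => ?_
        rw [hri, show f i - ((1 - t) * φ i + t * f i) = (1 - t) * (f i - φ i) by ring,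
          abs_mul, abs_of_pos ht1']
      have e : ∑ i, r i * Real.log (r i) =
          (1 - t) * ∑ i, φ i * Real.log (r i) + t * ∑ i, f i * Real.log (r i) := by
        rw [Finset.mul_sum, Finset.mul_sum, ← Finset.sum_add_distrib]
        refine Finset.sum_congr rfl fun i _ => ?_
        nth_rewrite 1 [hri i]
        ring
      rw [d1] at p1
      rw [d2] at p2
      have q1 := mul_le_mul_of_nonneg_left p1 ht1'.le
      have q2 := mul_le_mul_of_nonneg_left p2 ht0.le
      refine le_of_mul_le_mul_left ?_ ht0
      rw [e] at hmax
      linarith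
    have hd0 : 0 < d := hθ0.trans hd
    have hlt : θ ^ 2 < d ^ 2 := by nlinarith
    have hd2 : 0 < d ^ 2 := by positivity
    have hk := key ((d ^ 2 - θ ^ 2) / (2 * d ^ 2)) (div_pos (by linarith) (by positivity))
      (by rw [div_lt_one (by positivity)]; nlinarith [sq_nonneg θ])
    have e : (1 - (d ^ 2 - θ ^ 2) / (2 * d ^ 2)) * d ^ 2 = (d ^ 2 + θ ^ 2) / 2 := by
      field_simp
      ring
    rw [e] at hk
    linarith
end

section
/- Let m ≥ 2 be an integer and 0 < θ ≤ 1/2, and define ψ(α,θ) = θ²/2 − α·θ·ln(m/(α·θ)) for α ∈ (0,1). Then: (i) the function α ↦ ψ(α,θ) is strictly decreasing on (0,1); (ii) if m < (1/2)·θ³·e^{1/θ}, then ψ(α,θ) > 0 for all α ∈ (0, θ²/2]; (iii) ψ(1,θ) < 0 (where ψ(1,θ) = θ²/2 − θ·ln(m/θ)); consequently, if m < (1/2)·θ³·e^{1/θ}, the equation ψ(α,θ) = 0 has a unique root α₀ in the interval (θ²/2, 1). -/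
open BigOperators

/-- Properties of `ψ(α,θ) = θ²/2 − αθ·ln(m/(αθ))` for `m ≥ 2` and
`0 < θ ≤ 1/2`: (i) `α ↦ ψ(α,θ)` is strictly decreasing on `(0,1)`; (ii) if
`m < θ³e^{1/θ}/2` then `ψ(α,θ) > 0` for `α ∈ (0, θ²/2]`; (iii) `ψ(1,θ) < 0`;
consequently under the hypothesis of (ii) the equation `ψ(α,θ) = 0` has a unique
root `α₀ ∈ (θ²/2, 1)`. -/
theorem stmt_14 (m : ℕ) (hm : 2 ≤ m) (θ : ℝ) (hθ0 : 0 < θ) (hθ : θ ≤ 1 / 2)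
    (ψ : ℝ → ℝ) (hψ : ∀ α, ψ α = θ ^ 2 / 2 - α * θ * Real.log ((m : ℝ) / (α * θ))) :
    StrictAntiOn ψ (Set.Ioo 0 1) ∧
    ((m : ℝ) < (1 / 2) * θ ^ 3 * Real.exp (1 / θ) →
      ∀ α ∈ Set.Ioc (0 : ℝ) (θ ^ 2 / 2), 0 < ψ α) ∧
    ψ 1 < 0 ∧
    ((m : ℝ) < (1 / 2) * θ ^ 3 * Real.exp (1 / θ) →
      ∃! α₀, α₀ ∈ Set.Ioo (θ ^ 2 / 2) 1 ∧ ψ α₀ = 0) := by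
  have hm' : (2 : ℝ) ≤ m := by exact_mod_cast hm
  have hlog : ∀ y : ℝ, 0 < y → y ≤ 1 → 1 < Real.log ((m : ℝ) / (y * θ)) := by
    intro y hy hy1
    have hyθ : 0 < y * θ := mul_pos hy hθ0
    rw [Real.lt_log_iff_exp_lt (by positivity), lt_div_iff₀ hyθ]
    have h1 := Real.exp_one_lt_d9
    have h2 : y * θ ≤ 1 / 2 := by nlinarith
    have h3 : 0 < Real.exp 1 := Real.exp_pos 1
    nlinarith
  have hanti : StrictAntiOn ψ (Set.Ioc 0 1) := by
    rintro x ⟨hx, hx1⟩ y ⟨hy, hy1⟩ hxy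
    rw [hψ, hψ]
    have e : Real.log ((m : ℝ) / (x * θ)) = Real.log ((m : ℝ) / (y * θ)) + Real.log (y / x) := by
      rw [← Real.log_mul (by positivity) (by positivity)]
      congr 1
      field_simp
    have h1 := hlog y hy hy1
    have h2 : x * Real.log (y / x) ≤ y - x := by
      have h3 := Real.log_le_sub_one_of_pos (div_pos hy hx)
      have h4 := mul_le_mul_of_nonneg_left h3 hx.le
      have h5 : x * (y / x - 1) = y - x := by field_simp
      linarith
    have h6 : y - x < (y - x) * Real.log ((m : ℝ) / (y * θ)) := by
      nlinarith
    rw [e]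
    have h7 := mul_lt_mul_of_pos_left (lt_of_le_of_lt h2 h6) hθ0
    nlinarith
  have hθ2 : 0 < θ ^ 2 / 2 := by positivity
  have hθ21 : θ ^ 2 / 2 < 1 := by nlinarith
  have hpos : (m : ℝ) < (1 / 2) * θ ^ 3 * Real.exp (1 / θ) → 0 < ψ (θ ^ 2 / 2) := by
    intro h
    rw [hψ]
    have h1 : Real.log ((m : ℝ) / (θ ^ 2 / 2 * θ)) < 1 / θ := by
      rw [Real.log_lt_iff_lt_exp (by positivity), div_lt_iff₀ (by positivity)]
      linarith
    have h2 := mul_lt_mul_of_pos_left h1 (show 0 < θ ^ 2 / 2 * θ by positivity)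
    have h3 : θ ^ 2 / 2 * θ * (1 / θ) = θ ^ 2 / 2 := by field_simp
    linarith
  have hneg : ψ 1 < 0 := by
    rw [hψ]
    have h1 := hlog 1 one_pos le_rfl
    nlinarith
  refine ⟨hanti.mono Set.Ioo_subset_Ioc_self, ?_, hneg, ?_⟩
  · rintro h α ⟨h0, h1⟩
    exact (hpos h).trans_le
      (hanti.antitoneOn ⟨h0, h1.trans hθ21.le⟩ ⟨hθ2, hθ21.le⟩ h1)
  · intro h
    have hc : ContinuousOn ψ (Set.Icc (θ ^ 2 / 2) 1) := by
      have e : ψ = fun α => θ ^ 2 / 2 - α * θ * Real.log ((m : ℝ) / (α * θ)) := funext hψ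
      rw [e]
      have hne : ∀ x ∈ Set.Icc (θ ^ 2 / 2) 1, x * θ ≠ 0 := fun x hx =>
        (mul_pos (hθ2.trans_le hx.1) hθ0).ne'
      refine continuousOn_const.sub (ContinuousOn.mul (by fun_prop) (ContinuousOn.log
        (ContinuousOn.div continuousOn_const (by fun_prop) hne) ?_))
      intro x hx
      exact div_ne_zero (by positivity) (hne x hx)
    obtain ⟨a, ha, ha0⟩ := intermediate_value_Ioo' hθ21.le hc ⟨hneg, hpos h⟩
    refine ⟨a, ⟨ha, ha0⟩, ?_⟩
    rintro b ⟨hb, hb0⟩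
    exact hanti.injOn ⟨hθ2.trans hb.1, hb.2.le⟩ ⟨hθ2.trans ha.1, ha.2.le⟩ (hb0.trans ha0.symm)
end
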